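/- (De Giorgi-type result for sums of truncated kernels in two dimensions.) Let n = 2 and J = J₁ + J₂, where each J_i is a measurable even kernel satisfying, for constants 0 < δ₁ ≤ δ₀, 0 < λ ≤ Λ and 0 < α_i, β_i < 2: λ|z|^{−n−β_i}·1_{{|z| ≤ δ₁}} ≤ J_i(z) ≤ Λ|z|^{−n−α_i}·1_{{|z| ≤ δ₀}} for all z ≠ 0. Let u : ℝ² → ℝ be a bounded C³ solution, with bounded first, second and third derivatives, of L[u] + f(u) = 0 in ℝ² (f ∈ C¹(ℝ)), which is stable: for every compactly supported Lipschitz function ζ : ℝ² → ℝ, ∫_{ℝ²} f′(u(x)) ζ(x)² dx ≤ (1/2) ∬_{ℝ²×ℝ²} (ζ(x) − ζ(y))² (J₁(x−y) + J₂(x−y)) dx dy. Then u is one-dimensional: there exist a unit vector e ∈ ℝ² and a function g : ℝ → ℝ such that u(x) = g(e·x) for all x ∈ ℝ². -/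

import Mathlib

open MeasureTheory Filter Set Metric
open scoped Topology

noncomputable section

/-- The truncated nonlocal integral `∫_{{y : |x-y| > ε}} (u(y) - u(x)) J(x-y) dy`. -/
def truncI {n : ℕ} (J u : EuclideanSpace ℝ (Fin n) → ℝ)
    (x : EuclideanSpace ℝ (Fin n)) (ε : ℝ) : ℝ :=
  ∫ y in {y : EuclideanSpace ℝ (Fin n) | ε < dist x y}, (u y - u x) * J (x - y)

/-- `HasPV J u x ℓ` : the principal value `L[u](x) = lim_{ε→0⁺} ∫_{|x-y|>ε} (u(y)-u(x)) J(x-y) dy`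
exists and equals `ℓ`. -/
def HasPV {n : ℕ} (J u : EuclideanSpace ℝ (Fin n) → ℝ)
    (x : EuclideanSpace ℝ (Fin n)) (ℓ : ℝ) : Prop :=
  Tendsto (fun ε => truncI J u x ε) (𝓝[>] (0:ℝ)) (𝓝 ℓ)

/-- The Laplacian `Δu(x) = ∑ᵢ ∂²u/∂xᵢ²(x)`. -/
def lap {n : ℕ} (u : EuclideanSpace ℝ (Fin n) → ℝ) (x : EuclideanSpace ℝ (Fin n)) : ℝ :=
  ∑ i : Fin n, iteratedFDeriv ℝ 2 u x ![EuclideanSpace.single i 1, EuclideanSpace.single i 1]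

/-- `u` together with its iterated derivatives up to order `k` is bounded. -/
def BddDerivs {n : ℕ} (k : ℕ) (u : EuclideanSpace ℝ (Fin n) → ℝ) : Prop :=
  ∀ j ≤ k, ∃ M, ∀ x, ‖iteratedFDeriv ℝ j u x‖ ≤ M

/-- Variational stability of a solution `u`: for every compactly supported Lipschitz `ζ`,
`∫ f'(u) ζ² ≤ ∫ |∇ζ|² + (c/2) ∬ (ζ(x)-ζ(y))² J(x-y)`. -/
def IsStable {n : ℕ} (J : EuclideanSpace ℝ (Fin n) → ℝ) (c : ℝ)
    (f : ℝ → ℝ) (u : EuclideanSpace ℝ (Fin n) → ℝ) : Prop :=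
  ∀ ζ : EuclideanSpace ℝ (Fin n) → ℝ, (∃ K, LipschitzWith K ζ) → HasCompactSupport ζ →
    (∫ x, deriv f (u x) * ζ x ^ 2) ≤
      (∫ x, ‖gradient ζ x‖ ^ 2) + (c / 2) * ∫ x, ∫ y, (ζ x - ζ y) ^ 2 * J (x - y)

abbrev E2 := EuclideanSpace ℝ (Fin 2)

/-- Normalised kernel hypotheses. -/
structure KerOK (K : E2 → ℝ) (δ₀ δ₁ : ℝ) : Prop where
  meas : Measurable K
  nonneg : ∀ z, 0 ≤ K z
  even : ∀ z, K (-z) = K z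
  mom : Integrable (fun z => ‖z‖ ^ 2 * K z) volume
  supp : ∀ z, δ₀ < ‖z‖ → K z = 0
  pos : ∀ z, z ≠ 0 → ‖z‖ < δ₁ → 0 < K z
  hδ₁ : 0 < δ₁
  hδ : δ₁ ≤ δ₀

lemma KerOK.dom_int {K : E2 → ℝ} {δ₀ δ₁ : ℝ} (hK : KerOK K δ₀ δ₁) (C R : ℝ) :
    Integrable (fun p : E2 × E2 => (closedBall (0:E2) R).indicator (fun _ => C) p.1 *
      (‖p.2‖ ^ 2 * K p.2)) (volume.prod volume) := by
  refine Integrable.mul_prod (f := (closedBall (0:E2) R).indicator (fun _ => C)) ?_ hK.mom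
  rw [integrable_indicator_iff measurableSet_closedBall]
  exact integrableOn_const (measure_closedBall_lt_top.ne)

lemma KerOK.dom_bd {K : E2 → ℝ} {δ₀ δ₁ : ℝ} (hK : KerOK K δ₀ δ₁) {F : E2 × E2 → ℝ}
    {C R : ℝ} (hb : ∀ x z, ‖z‖ ≤ δ₀ → |F (x, z)| ≤ C * ‖z‖ ^ 2)
    (hs : ∀ x z, ‖z‖ ≤ δ₀ → R < ‖x‖ → F (x, z) = 0) (p : E2 × E2) :
    ‖F p * K p.2‖ ≤ (closedBall (0:E2) R).indicator (fun _ => C) p.1 * (‖p.2‖ ^ 2 * K p.2) := by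
  obtain ⟨x, z⟩ := p
  simp only
  by_cases hz : ‖z‖ ≤ δ₀
  · by_cases hx : ‖x‖ ≤ R
    · rw [indicator_of_mem (by simpa using hx), norm_mul, Real.norm_eq_abs, Real.norm_eq_abs,
        abs_of_nonneg (hK.nonneg z), ← mul_assoc]
      exact mul_le_mul_of_nonneg_right (hb x z hz) (hK.nonneg z)
    · rw [indicator_of_notMem (by simpa using hx), hs x z hz (not_le.1 hx)]
      simp
  · simp [hK.supp z (not_le.1 hz)]

lemma KerOK.int {K : E2 → ℝ} {δ₀ δ₁ : ℝ} (hK : KerOK K δ₀ δ₁) {F : E2 × E2 → ℝ}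
    (hF : Continuous F) {C R : ℝ} (hb : ∀ x z, ‖z‖ ≤ δ₀ → |F (x, z)| ≤ C * ‖z‖ ^ 2)
    (hs : ∀ x z, ‖z‖ ≤ δ₀ → R < ‖x‖ → F (x, z) = 0) :
    Integrable (fun p : E2 × E2 => F p * K p.2) (volume.prod volume) := by
  refine (hK.dom_int C R).mono' ?_ (Eventually.of_forall (hK.dom_bd hb hs))
  exact (hF.measurable.mul (hK.meas.comp measurable_snd)).aestronglyMeasurable

/-- Continuous Lipschitz-type difference bound. -/
def LipR (C : ℝ) (a : E2 → ℝ) : Prop := ∀ x z, |a (x + z) - a x| ≤ C * ‖z‖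

lemma lipR_of {C : NNReal} {a : E2 → ℝ} (h : LipschitzWith C a) : LipR C a := by
  intro x z
  have := h.dist_le_mul (x + z) x
  simpa [Real.dist_eq, dist_eq_norm] using this

lemma LipR.nonneg {C : ℝ} {a : E2 → ℝ} (h : LipR C a) : 0 ≤ C := by
  have h1 := h 0 (EuclideanSpace.single 0 1)
  have : ‖(EuclideanSpace.single 0 1 : E2)‖ = 1 := by simp
  rw [this] at h1
  linarith [abs_nonneg (a (0 + EuclideanSpace.single 0 1) - a 0)]

lemma LipR.lip {C : ℝ} {a : E2 → ℝ} (h : LipR C a) : LipschitzWith ⟨C, h.nonneg⟩ a := by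
  refine LipschitzWith.of_dist_le_mul fun x y => ?_
  have := h y (x - y)
  rw [add_sub_cancel] at this
  rw [Real.dist_eq, dist_eq_norm]
  exact this

lemma LipR.cont {C : ℝ} {a : E2 → ℝ} (h : LipR C a) : Continuous a := h.lip.continuous

lemma dd_cont {a b : E2 → ℝ} (ha : Continuous a) (hb : Continuous b) :
    Continuous (fun p : E2 × E2 => (a (p.1 + p.2) - a p.1) * (b (p.1 + p.2) - b p.1)) := by
  fun_prop

lemma dd_bd {a b : E2 → ℝ} {A B : ℝ} (ha : LipR A a) (hb : LipR B b) (x z : E2) :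
    |(a (x + z) - a x) * (b (x + z) - b x)| ≤ (A * B) * ‖z‖ ^ 2 := by
  rw [abs_mul]
  calc _ ≤ (A * ‖z‖) * (B * ‖z‖) :=
        mul_le_mul (ha x z) (hb x z) (abs_nonneg _) (mul_nonneg ha.nonneg (norm_nonneg _))
    _ = _ := by ring

lemma dd_supp {a b : E2 → ℝ} {R δ₀ : ℝ} (hs : ∀ x, R < ‖x‖ → b x = 0) (x z : E2)
    (hz : ‖z‖ ≤ δ₀) (hx : R + δ₀ < ‖x‖) : (a (x + z) - a x) * (b (x + z) - b x) = 0 := by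
  have h0 : 0 ≤ ‖z‖ := norm_nonneg z
  have h1 : R < ‖x‖ := by linarith
  have h2 : R < ‖x + z‖ := by
    have : ‖x‖ ≤ ‖x + z‖ + ‖z‖ := by
      simpa using norm_sub_le (x + z) z
    linarith
  rw [hs _ h1, hs _ h2]; simp

lemma dd_int {K : E2 → ℝ} {δ₀ δ₁ : ℝ} (hK : KerOK K δ₀ δ₁) {a b : E2 → ℝ} {A B R : ℝ}
    (ha : LipR A a) (hb : LipR B b) (hs : ∀ x, R < ‖x‖ → b x = 0) :
    Integrable (fun p : E2 × E2 => ((a (p.1 + p.2) - a p.1) * (b (p.1 + p.2) - b p.1)) * K p.2)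
      (volume.prod volume) :=
  hK.int (dd_cont ha.cont hb.cont) (fun x z _ => dd_bd ha hb x z)
    (fun x z hz hx => dd_supp hs x z hz hx)

lemma supp_bd {b : E2 → ℝ} (hb : HasCompactSupport b) : ∃ R, ∀ x, R < ‖x‖ → b x = 0 := by
  obtain ⟨R, hR⟩ := hb.isCompact.isBounded.subset_closedBall (0:E2)
  refine ⟨R, fun x hx => ?_⟩
  by_contra h
  have := hR (subset_tsupport b h)
  simp at this
  linarith

/-- Truncated kernel. -/
def Ke (K : E2 → ℝ) (ε : ℝ) (z : E2) : ℝ := if ε < ‖z‖ then K z else 0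

section trunc
variable {K : E2 → ℝ} {δ₀ δ₁ : ℝ}

lemma Ke_meas (hK : KerOK K δ₀ δ₁) (ε : ℝ) : Measurable (Ke K ε) :=
  Measurable.ite (measurableSet_lt measurable_const measurable_norm) hK.meas measurable_const

lemma Ke_even (hK : KerOK K δ₀ δ₁) (ε : ℝ) (z : E2) : Ke K ε (-z) = Ke K ε z := by
  simp [Ke, hK.even]

lemma Ke_nonneg (hK : KerOK K δ₀ δ₁) (ε : ℝ) (z : E2) : 0 ≤ Ke K ε z := by
  unfold Ke; split_ifs
  · exact hK.nonneg z
  · exact le_rfl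

lemma Ke_le (hK : KerOK K δ₀ δ₁) (ε : ℝ) (z : E2) : Ke K ε z ≤ K z := by
  unfold Ke; split_ifs
  · exact le_rfl
  · exact hK.nonneg z

lemma Ke_int (hK : KerOK K δ₀ δ₁) {ε : ℝ} (hε : 0 < ε) : Integrable (Ke K ε) volume := by
  refine (hK.mom.const_mul (ε ^ 2)⁻¹).mono' (Ke_meas hK ε).aestronglyMeasurable
    (Eventually.of_forall fun z => ?_)
  rw [Real.norm_eq_abs, abs_of_nonneg (Ke_nonneg hK ε z)]
  unfold Ke; split_ifs with h
  · rw [← mul_assoc]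
    refine le_mul_of_one_le_left (hK.nonneg z) ?_
    rw [← div_eq_inv_mul, one_le_div (by positivity)]
    exact pow_le_pow_left₀ hε.le h.le 2
  · have := hK.nonneg z
    positivity

lemma truncI_eq (hK : KerOK K δ₀ δ₁) (u : E2 → ℝ) (x : E2) (ε : ℝ) :
    truncI K u x ε = ∫ z, (u (x + z) - u x) * Ke K ε z := by
  unfold truncI
  have hm : MeasurableSet {y : E2 | ε < dist x y} :=
    measurableSet_lt measurable_const (measurable_const.dist measurable_id)
  rw [← integral_indicator hm, ← integral_add_left_eq_self _ x]
  congr 1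
  ext z
  by_cases h : ε < ‖z‖
  · rw [indicator_of_mem (by simpa using h)]
    simp [Ke, h, hK.even]
  · rw [indicator_of_notMem (by simpa using h)]
    simp [Ke, h]

lemma second_diff {u : E2 → ℝ} (hu : Differentiable ℝ u) {C : ℝ}
    (hC : ∀ x y, ‖fderiv ℝ u x - fderiv ℝ u y‖ ≤ C * ‖x - y‖) (hC0 : 0 ≤ C) (x z : E2) :
    |u (x + z) + u (x - z) - 2 * u x| ≤ 2 * C * ‖z‖ ^ 2 := by
  have hd : ∀ y : E2, HasFDerivAt (fun y => u (x + y) + u (x - y))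
      (fderiv ℝ u (x + y) - fderiv ℝ u (x - y)) y := by
    intro y
    have h1 : HasFDerivAt (fun y => u (x + y)) (fderiv ℝ u (x + y)) y := by
      have := (hu (x + y)).hasFDerivAt.comp y ((hasFDerivAt_id y).const_add x)
      rw [ContinuousLinearMap.comp_id] at this
      exact this
    have h2 : HasFDerivAt (fun y => u (x - y)) (-fderiv ℝ u (x - y)) y := by
      have := (hu (x - y)).hasFDerivAt.comp y ((hasFDerivAt_id y).const_sub x)
      rw [ContinuousLinearMap.comp_neg, ContinuousLinearMap.comp_id] at this
      exact this
    rw [sub_eq_add_neg (fderiv ℝ u (x + y))]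
    exact h1.add h2
  have key := Convex.norm_image_sub_le_of_norm_hasFDerivWithin_le
    (f := fun y => u (x + y) + u (x - y)) (s := closedBall (0:E2) ‖z‖) (C := 2 * C * ‖z‖)
    (x := 0) (y := z)
    (fun y _ => (hd y).hasFDerivWithinAt) (fun y hy => by
      have hy' : ‖y‖ ≤ ‖z‖ := by simpa using hy
      refine (hC _ _).trans ?_
      have : x + y - (x - y) = (2:ℝ) • y := by rw [two_smul]; abel
      rw [this, norm_smul]; simp
      nlinarith) (convex_closedBall _ _) (by simp) (by simp)
  simp only [add_zero, sub_zero, Real.norm_eq_abs] at key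
  have e : u (x + z) + u (x - z) - (u x + u x) = u (x + z) + u (x - z) - 2 * u x := by ring
  rw [e] at key
  calc _ ≤ _ := key
    _ = _ := by ring

lemma truncI_bd (hK : KerOK K δ₀ δ₁) {u : E2 → ℝ} (hu : Differentiable ℝ u) {C M : ℝ}
    (hC : ∀ x y, ‖fderiv ℝ u x - fderiv ℝ u y‖ ≤ C * ‖x - y‖) (hC0 : 0 ≤ C)
    (hM : ∀ x, |u x| ≤ M) (x : E2) {ε : ℝ} (hε : 0 < ε) :
    |truncI K u x ε| ≤ C * ∫ z, ‖z‖ ^ 2 * K z := by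
  rw [truncI_eq hK]
  have hi : Integrable (fun z => (u (x + z) - u x) * Ke K ε z) volume := by
    refine (Ke_int hK hε).bdd_mul (c := 2 * M) ?_ (Eventually.of_forall fun z => ?_)
    · exact ((hu.continuous.comp (continuous_const.add continuous_id)).sub
        continuous_const).aestronglyMeasurable
    · rw [Real.norm_eq_abs]
      have := hM (x + z); have := hM x
      rw [abs_le] at *
      constructor <;> linarith
  have hi2 := hi.comp_neg
  have e := integral_neg_eq_self (fun z => (u (x + z) - u x) * Ke K ε z) volume
  have e2 : ∫ z, (u (x + z) - u x) * Ke K ε z =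
      (1/2) * ∫ z, (u (x + z) + u (x - z) - 2 * u x) * Ke K ε z := by
    have : ∫ z, (u (x + z) + u (x - z) - 2 * u x) * Ke K ε z
        = (∫ z, (u (x + z) - u x) * Ke K ε z) + ∫ z, (u (x + -z) - u x) * Ke K ε (-z) := by
      rw [← integral_add hi hi2]
      congr 1; ext z
      rw [Ke_even hK, ← sub_eq_add_neg]; ring
    rw [this, e]; ring
  rw [e2, abs_mul]
  have : ‖∫ z, (u (x + z) + u (x - z) - 2 * u x) * Ke K ε z‖ ≤
      ∫ z, 2 * C * (‖z‖ ^ 2 * K z) := by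
    refine norm_integral_le_of_norm_le (hK.mom.const_mul _) (Eventually.of_forall fun z => ?_)
    rw [norm_mul, Real.norm_eq_abs, Real.norm_eq_abs, abs_of_nonneg (Ke_nonneg hK ε z),
      ← mul_assoc]
    exact mul_le_mul (second_diff hu hC hC0 x z) (Ke_le hK ε z) (Ke_nonneg hK ε z)
      (by positivity)
  rw [integral_const_mul, Real.norm_eq_abs] at this
  rw [abs_of_pos (by norm_num : (0:ℝ) < 1/2)]
  linarith

/-- Symmetrisation at positive truncation. -/
lemma trunc_pair (hK : KerOK K δ₀ δ₁) {u ψ : E2 → ℝ} (hu : Continuous u) {M : ℝ}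
    (hM : ∀ x, |u x| ≤ M) (hψ : Continuous ψ) (hψs : HasCompactSupport ψ) {ε : ℝ} (hε : 0 < ε) :
    Integrable (fun x => truncI K u x ε * ψ x) volume ∧
    ∫ x, truncI K u x ε * ψ x = -(1/2) * ∫ p : E2 × E2,
      ((u (p.1 + p.2) - u p.1) * (ψ (p.1 + p.2) - ψ p.1)) * Ke K ε p.2
        ∂(volume.prod volume) := by
  set H : E2 × E2 → ℝ := fun p => (u (p.1 + p.2) - u p.1) * (ψ p.1 * Ke K ε p.2) with hH
  have hHi : Integrable H (volume.prod volume) := by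
    refine Integrable.bdd_mul (c := 2 * M)
      (Integrable.mul_prod (hψ.integrable_of_hasCompactSupport hψs) (Ke_int hK hε)) ?_
      (Eventually.of_forall fun z => ?_)
    · exact (by fun_prop : Continuous fun p : E2 × E2 => u (p.1 + p.2) - u p.1).aestronglyMeasurable
    · rw [Real.norm_eq_abs]
      have := hM (z.1 + z.2); have := hM z.1
      rw [abs_le] at *
      constructor <;> linarith
  have hx : ∀ x, truncI K u x ε * ψ x = ∫ z, H (x, z) := by
    intro x
    rw [truncI_eq hK, ← integral_mul_const]
    congr 1; ext z; simp only [hH]; ring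
  have hT : MeasurePreserving (fun p : E2 × E2 => (p.1 + p.2, -p.2)) (volume.prod volume)
      (volume.prod volume) :=
    (measurePreserving_add_prod_neg (volume : Measure E2) volume).comp
      (Measure.measurePreserving_swap)
  have hHT : Integrable (fun p : E2 × E2 => H (p.1 + p.2, -p.2)) (volume.prod volume) :=
    hT.integrable_comp_of_integrable hHi
  have hHTe : ∫ p : E2 × E2, H (p.1 + p.2, -p.2) ∂(volume.prod volume) =
      ∫ p, H p ∂(volume.prod volume) := by
    conv_rhs => rw [← hT.map_eq]
    rw [integral_map hT.measurable.aemeasurable]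
    rw [hT.map_eq]; exact hHi.aestronglyMeasurable
  simp_rw [hx]
  refine ⟨hHi.integral_prod_left, ?_⟩
  rw [← integral_prod _ hHi]
  have : ∫ p : E2 × E2, ((u (p.1 + p.2) - u p.1) * (ψ (p.1 + p.2) - ψ p.1)) * Ke K ε p.2
        ∂(volume.prod volume) = - (∫ p, H p ∂(volume.prod volume)) -
        ∫ p : E2 × E2, H (p.1 + p.2, -p.2) ∂(volume.prod volume) := by
    rw [← integral_neg, ← integral_sub (f := fun p => - H p) hHi.neg hHT]
    congr 1; ext p
    simp only [hH, Ke_even hK, add_neg_cancel_right]; ring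
  rw [this, hHTe]; ring

lemma pv_pair (hK : KerOK K δ₀ δ₁) {u ψ : E2 → ℝ} (hu : Differentiable ℝ u) {C M A B : ℝ}
    (hC : ∀ x y, ‖fderiv ℝ u x - fderiv ℝ u y‖ ≤ C * ‖x - y‖) (hC0 : 0 ≤ C)
    (hM : ∀ x, |u x| ≤ M) (huL : LipR A u) (hψ : LipR B ψ) (hψs : HasCompactSupport ψ)
    {Lu : E2 → ℝ} (hLu : ∀ x, HasPV K u x (Lu x)) :
    ∫ x, Lu x * ψ x = -(1/2) * ∫ p : E2 × E2,
      ((u (p.1 + p.2) - u p.1) * (ψ (p.1 + p.2) - ψ p.1)) * K p.2 ∂(volume.prod volume) := by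
  obtain ⟨R, hR⟩ := supp_bd hψs
  have hpos : ∀ᶠ ε : ℝ in 𝓝[>] 0, 0 < ε := eventually_mem_nhdsWithin
  have h1 : Tendsto (fun ε => ∫ x, truncI K u x ε * ψ x) (𝓝[>] (0:ℝ)) (𝓝 (∫ x, Lu x * ψ x)) := by
    refine tendsto_integral_filter_of_dominated_convergence
      (fun x => (C * ∫ z, ‖z‖ ^ 2 * K z) * |ψ x|) ?_ ?_ ?_ ?_
    · filter_upwards [hpos] with ε hε
      exact (trunc_pair hK hu.continuous hM hψ.cont hψs hε).1.aestronglyMeasurable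
    · filter_upwards [hpos] with ε hε
      refine Eventually.of_forall fun x => ?_
      rw [norm_mul]
      exact mul_le_mul_of_nonneg_right (truncI_bd hK hu hC hC0 hM x hε) (abs_nonneg _)
    · exact (hψ.cont.integrable_of_hasCompactSupport hψs).abs.const_mul _
    · exact Eventually.of_forall fun x => (hLu x).mul_const _
  have h2 : Tendsto (fun ε => ∫ p : E2 × E2,
      ((u (p.1 + p.2) - u p.1) * (ψ (p.1 + p.2) - ψ p.1)) * Ke K ε p.2 ∂(volume.prod volume))
      (𝓝[>] (0:ℝ)) (𝓝 (∫ p : E2 × E2,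
      ((u (p.1 + p.2) - u p.1) * (ψ (p.1 + p.2) - ψ p.1)) * K p.2 ∂(volume.prod volume))) := by
    refine tendsto_integral_filter_of_dominated_convergence
      (fun p => ‖((u (p.1 + p.2) - u p.1) * (ψ (p.1 + p.2) - ψ p.1)) * K p.2‖) ?_ ?_ ?_ ?_
    · refine Eventually.of_forall fun ε => ?_
      exact ((dd_cont huL.cont hψ.cont).measurable.mul
        ((Ke_meas hK ε).comp measurable_snd)).aestronglyMeasurable
    · refine Eventually.of_forall fun ε => Eventually.of_forall fun p => ?_
      rw [norm_mul, norm_mul _ (K p.2)]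
      refine mul_le_mul_of_nonneg_left ?_ (norm_nonneg _)
      rw [Real.norm_eq_abs, Real.norm_eq_abs, abs_of_nonneg (Ke_nonneg hK ε _),
        abs_of_nonneg (hK.nonneg _)]
      exact Ke_le hK ε _
    · exact (dd_int hK huL hψ hR).norm
    · refine Eventually.of_forall fun p => ?_
      by_cases hp : p.2 = 0
      · simp [hp]
      · refine tendsto_const_nhds.congr' ?_
        have : ∀ᶠ ε : ℝ in 𝓝[>] 0, ε < ‖p.2‖ :=
          nhdsWithin_le_nhds (eventually_lt_nhds (norm_pos_iff.2 hp))
        filter_upwards [this] with ε hε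
        simp [Ke, hε]
  refine tendsto_nhds_unique h1 ((h2.const_mul (-(1/2))).congr' ?_)
  filter_upwards [hpos] with ε hε
  exact ((trunc_pair hK hu.continuous hM hψ.cont hψs hε).2).symm

end trunc

lemma ibp {f g : E2 → ℝ} (hf : ContDiff ℝ 1 f) (hg : ContDiff ℝ 1 g) (hgs : HasCompactSupport g)
    (a : E2) : ∫ x, f x * (fderiv ℝ g x) a = -∫ x, (fderiv ℝ f x) a * g x := by
  have hfd : Continuous fun x => fderiv ℝ f x a :=
    (hf.continuous_fderiv one_ne_zero).clm_apply continuous_const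
  have hgd : Continuous fun x => fderiv ℝ g x a :=
    (hg.continuous_fderiv one_ne_zero).clm_apply continuous_const
  refine integral_mul_fderiv_eq_neg_fderiv_mul_of_integrable ?_ ?_ ?_
    (fun x _ => (hf.differentiable one_ne_zero) x) (fun x _ => (hg.differentiable one_ne_zero) x)
  · exact (hfd.mul hg.continuous).integrable_of_hasCompactSupport hgs.mul_left
  · exact (hf.continuous.mul hgd).integrable_of_hasCompactSupport
      (hgs.fderiv_apply ℝ a).mul_left
  · exact (hf.continuous.mul hg.continuous).integrable_of_hasCompactSupport hgs.mul_left

lemma fderiv_shift {f : E2 → ℝ} (hf : Differentiable ℝ f) (z x a : E2) :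
    fderiv ℝ (fun x => f (x + z) - f x) x a = fderiv ℝ f (x + z) a - fderiv ℝ f x a := by
  have h1 : DifferentiableAt ℝ (fun x => f (x + z)) x :=
    (hf (x + z)).comp x (differentiableAt_id.add_const z)
  rw [fderiv_fun_sub h1 (hf x), fderiv_comp_add_right]
  rfl

lemma lipR_compact {b : E2 → ℝ} (hb : ContDiff ℝ 1 b) (hs : HasCompactSupport b) :
    ∃ B, LipR B b := by
  obtain ⟨C, hC⟩ := hb.lipschitzWith_of_hasCompactSupport hs one_ne_zero
  exact ⟨C, lipR_of hC⟩

lemma pair_ibp {K : E2 → ℝ} {δ₀ δ₁ : ℝ} (hK : KerOK K δ₀ δ₁) {u φ : E2 → ℝ} (hu : ContDiff ℝ 1 u)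
    {A A' : ℝ} (a : E2) (huL : LipR A u) (hvL : LipR A' (fun x => fderiv ℝ u x a))
    (hφ : ContDiff ℝ 2 φ) (hφs : HasCompactSupport φ) :
    ∫ p : E2 × E2, ((u (p.1 + p.2) - u p.1) *
        (fderiv ℝ φ (p.1 + p.2) a - fderiv ℝ φ p.1 a)) * K p.2 ∂(volume.prod volume) =
    -∫ p : E2 × E2, ((fderiv ℝ u (p.1 + p.2) a - fderiv ℝ u p.1 a) *
        (φ (p.1 + p.2) - φ p.1)) * K p.2 ∂(volume.prod volume) := by
  have hφ1 : ContDiff ℝ 1 φ := hφ.of_le (by norm_num)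
  have hψ1 : ContDiff ℝ 1 (fun x => fderiv ℝ φ x a) :=
    (hφ.fderiv_right (m := 1) (by norm_num)).clm_apply contDiff_const
  have hψs : HasCompactSupport (fun x => fderiv ℝ φ x a) := hφs.fderiv_apply ℝ a
  obtain ⟨B, hB⟩ := lipR_compact hφ1 hφs
  obtain ⟨B', hB'⟩ := lipR_compact hψ1 hψs
  obtain ⟨R, hR⟩ := supp_bd hφs
  obtain ⟨R', hR'⟩ := supp_bd hψs
  rw [integral_prod_symm _ (dd_int hK huL hB' hR'), integral_prod_symm _ (dd_int hK hvL hB hR),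
    ← integral_neg]
  congr 1; ext z
  simp only
  rw [integral_mul_const, integral_mul_const, ← neg_mul]
  congr 1
  have hsh : ∀ {f : E2 → ℝ}, ContDiff ℝ 1 f → ContDiff ℝ 1 (fun x => f (x + z) - f x) :=
    fun hf => (hf.comp (contDiff_id.add contDiff_const)).sub hf
  have hcs : HasCompactSupport (fun x => φ (x + z) - φ x) := by
    refine HasCompactSupport.intro (isCompact_closedBall (0:E2) (R + ‖z‖)) fun x hx => ?_
    have hx : R + ‖z‖ < ‖x‖ := by simpa using hx
    have h2 : ‖x‖ ≤ ‖x + z‖ + ‖z‖ := by simpa using norm_sub_le (x + z) z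
    rw [hR x (by linarith [norm_nonneg z]), hR (x + z) (by linarith), sub_zero]
  have := ibp (hsh hu) (hsh hφ1) hcs a
  simp_rw [fderiv_shift (hu.differentiable one_ne_zero),
    fderiv_shift (hφ1.differentiable one_ne_zero)] at this
  exact this

/-- The weak linearised equation. -/
lemma weak_lin {K : E2 → ℝ} {δ₀ δ₁ : ℝ} (hK : KerOK K δ₀ δ₁) {u φ : E2 → ℝ} (hu : ContDiff ℝ 1 u)
    {f : ℝ → ℝ} (hf : ContDiff ℝ 1 f)
    {A A' C M : ℝ} (a : E2) (huL : LipR A u) (hvL : LipR A' (fun x => fderiv ℝ u x a))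
    (hC : ∀ x y, ‖fderiv ℝ u x - fderiv ℝ u y‖ ≤ C * ‖x - y‖) (hC0 : 0 ≤ C)
    (hM : ∀ x, |u x| ≤ M)
    {Lu : E2 → ℝ} (hLu : ∀ x, HasPV K u x (Lu x)) (heq : ∀ x, Lu x + f (u x) = 0)
    (hφ : ContDiff ℝ 2 φ) (hφs : HasCompactSupport φ) :
    ∫ x, deriv f (u x) * (fderiv ℝ u x a * φ x) =
    (1/2) * ∫ p : E2 × E2, ((fderiv ℝ u (p.1 + p.2) a - fderiv ℝ u p.1 a) *
        (φ (p.1 + p.2) - φ p.1)) * K p.2 ∂(volume.prod volume) := by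
  have hφ1 : ContDiff ℝ 1 φ := hφ.of_le (by norm_num)
  have hψ1 : ContDiff ℝ 1 (fun x => fderiv ℝ φ x a) :=
    (hφ.fderiv_right (m := 1) (by norm_num)).clm_apply contDiff_const
  have hψs : HasCompactSupport (fun x => fderiv ℝ φ x a) := hφs.fderiv_apply ℝ a
  obtain ⟨B', hB'⟩ := lipR_compact hψ1 hψs
  have h1 := pv_pair hK (hu.differentiable one_ne_zero) hC hC0 hM huL hB' hψs hLu
  have h2 := pair_ibp hK hu a huL hvL hφ hφs
  rw [h2] at h1
  have h3 := ibp (f := fun x => f (u x)) (hf.comp hu) hφ1 hφs a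
  have h4 : ∀ x, fderiv ℝ (fun x => f (u x)) x a = deriv f (u x) * fderiv ℝ u x a := by
    intro x
    have := ((hf.differentiable one_ne_zero (u x)).hasDerivAt.comp_hasFDerivAt x
      (hu.differentiable one_ne_zero x).hasFDerivAt).fderiv
    have e : (fun x => f (u x)) = f ∘ u := rfl
    rw [e, this]; simp
  simp_rw [h4] at h3
  have h5 : ∀ x, Lu x = - f (u x) := fun x => by linarith [heq x]
  simp_rw [h5, neg_mul] at h1
  rw [integral_neg, h3] at h1
  simp_rw [← mul_assoc]
  linarith

/-- Conversion of the stability double integral. -/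
lemma stab_conv {J K : E2 → ℝ} {δ₀ δ₁ : ℝ} (hK : KerOK K δ₀ δ₁) (hJ : ∀ z, z ≠ 0 → J z = K z)
    {ζ : E2 → ℝ} {A R : ℝ} (hζ : LipR A ζ) (hs : ∀ x, R < ‖x‖ → ζ x = 0) :
    ∫ x, ∫ y, (ζ x - ζ y) ^ 2 * J (x - y) =
     ∫ p : E2 × E2, ((ζ (p.1 + p.2) - ζ p.1) * (ζ (p.1 + p.2) - ζ p.1)) * K p.2
      ∂(volume.prod volume) := by
  rw [integral_prod _ (dd_int hK hζ hζ hs)]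
  congr 1; ext x
  rw [← integral_add_left_eq_self _ x]
  refine integral_congr_ae ?_
  filter_upwards with z
  by_cases hz : z = 0
  · simp [hz]
  · have : x - (x + z) = -z := by abel
    simp only [this]
    rw [hJ _ (neg_ne_zero.2 hz), hK.even]; ring

lemma smoothTransition_lip : ∃ S : NNReal, LipschitzWith S Real.smoothTransition := by
  have hc : ContDiff ℝ 1 Real.smoothTransition := Real.smoothTransition.contDiff (n := 1)
  have hd : Continuous (deriv Real.smoothTransition) := hc.continuous_deriv le_rfl
  have hs : HasCompactSupport (deriv Real.smoothTransition) := by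
    refine HasCompactSupport.intro (isCompact_Icc (a := (0:ℝ)) (b := 1)) fun x hx => ?_
    rcases lt_or_ge x 0 with h | h
    · have : Real.smoothTransition =ᶠ[𝓝 x] fun _ => (0:ℝ) := by
        filter_upwards [Iio_mem_nhds h] with y hy
        exact Real.smoothTransition.zero_of_nonpos (le_of_lt hy)
      rw [this.deriv_eq]; simp
    · have h1 : 1 < x := by
        by_contra h1
        exact hx ⟨h, not_lt.1 h1⟩
      have : Real.smoothTransition =ᶠ[𝓝 x] fun _ => (1:ℝ) := by
        filter_upwards [Ioi_mem_nhds h1] with y hy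
        exact Real.smoothTransition.one_of_one_le (le_of_lt hy)
      rw [this.deriv_eq]; simp
  obtain ⟨C, hC⟩ := hd.bounded_above_of_compact_support hs
  refine ⟨C.toNNReal, lipschitzWith_of_nnnorm_deriv_le (hc.differentiable one_ne_zero) fun x => ?_⟩
  rw [← NNReal.coe_le_coe, coe_nnnorm]
  exact (hC x).trans (Real.le_coe_toNNReal C)

lemma log_diff {δ₀ : ℝ} (x z : E2) (hz : ‖z‖ ≤ δ₀) :
    (Real.log (1 + ‖x + z‖ ^ 2) - Real.log (1 + ‖x‖ ^ 2)) ^ 2 ≤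
      (2 * (2 + 2 * δ₀ ^ 2) ^ 2 * (1 + (2 + 2 * δ₀ ^ 2))) * ‖z‖ ^ 2 * (1 + ‖x‖ ^ 2)⁻¹ := by
  set c := 2 + 2 * δ₀ ^ 2 with hc
  have hc1 : 1 ≤ c := by nlinarith [sq_nonneg δ₀]
  have t1 : ‖x‖ ≤ ‖x + z‖ + ‖z‖ := by simpa using norm_sub_le (x + z) z
  have t2 : ‖x + z‖ ≤ ‖x‖ + ‖z‖ := norm_add_le x z
  have n1 := norm_nonneg x
  have n2 := norm_nonneg z
  have n3 := norm_nonneg (x + z)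
  generalize ‖x‖ = X at *
  generalize ‖z‖ = Z at *
  generalize ‖x + z‖ = Y at *
  have hZ : Z ^ 2 ≤ δ₀ ^ 2 := pow_le_pow_left₀ n2 hz 2
  set a := 1 + X ^ 2 with ha
  set b := 1 + Y ^ 2 with hb
  have ha0 : 0 < a := by positivity
  have hb0 : 0 < b := by positivity
  have hab : a ≤ c * b := by
    have : X ^ 2 ≤ (Y + Z) ^ 2 := pow_le_pow_left₀ n1 t1 2
    nlinarith [sq_nonneg (Y - Z), mul_nonneg (sq_nonneg δ₀) (sq_nonneg Y)]
  have hba : b ≤ c * a := by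
    have : Y ^ 2 ≤ (X + Z) ^ 2 := pow_le_pow_left₀ n3 t2 2
    nlinarith [sq_nonneg (X - Z), mul_nonneg (sq_nonneg δ₀) (sq_nonneg X)]
  have hd : (b - a) ^ 2 ≤ Z ^ 2 * (2 * (1 + c) * a) := by
    have e : b - a = (Y - X) * (Y + X) := by rw [ha, hb]; ring
    have h1 : (Y - X) ^ 2 ≤ Z ^ 2 := by
      apply sq_le_sq'  <;> linarith
    have h2 : (Y + X) ^ 2 ≤ 2 * (1 + c) * a := by nlinarith [sq_nonneg (Y - X)]
    rw [e, mul_pow]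
    exact mul_le_mul h1 h2 (sq_nonneg _) (sq_nonneg _)
  have hl : |Real.log b - Real.log a| ≤ c * |b - a| / a := by
    rw [abs_le]
    have l1 : Real.log b - Real.log a ≤ (b - a) / a := by
      rw [← Real.log_div hb0.ne' ha0.ne']
      refine (Real.log_le_sub_one_of_pos (by positivity)).trans (le_of_eq ?_)
      field_simp
    have l2 : Real.log a - Real.log b ≤ (a - b) / b := by
      rw [← Real.log_div ha0.ne' hb0.ne']
      refine (Real.log_le_sub_one_of_pos (by positivity)).trans (le_of_eq ?_)
      field_simp
    have l3 : (b - a) / a ≤ c * |b - a| / a := by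
      gcongr
      nlinarith [le_abs_self (b - a), abs_nonneg (b - a)]
    have l4 : (a - b) / b ≤ c * |b - a| / a := by
      rw [div_le_div_iff₀ hb0 ha0]
      have : a - b ≤ |b - a| := by rw [abs_sub_comm]; exact le_abs_self _
      calc (a - b) * a ≤ |b - a| * a := by gcongr
        _ ≤ |b - a| * (c * b) := by gcongr
        _ = _ := by ring
    constructor <;> linarith
  calc (Real.log b - Real.log a) ^ 2 = |Real.log b - Real.log a| ^ 2 := (sq_abs _).symm
    _ ≤ (c * |b - a| / a) ^ 2 := pow_le_pow_left₀ (abs_nonneg _) hl 2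
    _ = c ^ 2 * (b - a) ^ 2 / a ^ 2 := by rw [div_pow, mul_pow, sq_abs]
    _ ≤ c ^ 2 * (Z ^ 2 * (2 * (1 + c) * a)) / a ^ 2 := by gcongr
    _ = _ := by field_simp

lemma radial_int {R : ℝ} (hR : 0 ≤ R) :
    Integrable (fun x : E2 => (closedBall (0:E2) R).indicator (fun x => (1 + ‖x‖ ^ 2)⁻¹) x) volume ∧
    ∫ x : E2, (closedBall (0:E2) R).indicator (fun x => (1 + ‖x‖ ^ 2)⁻¹) x =
      (volume : Measure E2).real (ball 0 1) * Real.log (1 + R ^ 2) := by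
  constructor
  · rw [integrable_indicator_iff measurableSet_closedBall]
    refine ContinuousOn.integrableOn_compact (isCompact_closedBall _ _) ?_
    refine Continuous.continuousOn ?_
    exact Continuous.inv₀ (by fun_prop) (fun x => by positivity)
  · have h := integral_fun_norm_addHaar (volume : Measure E2)
      (fun r : ℝ => (Iic R).indicator (fun r => (1 + r ^ 2)⁻¹) r)
    have e : ∀ x : E2, (closedBall (0:E2) R).indicator (fun x => (1 + ‖x‖ ^ 2)⁻¹) x =
        (Iic R).indicator (fun r : ℝ => (1 + r ^ 2)⁻¹) ‖x‖ := by
      intro x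
      by_cases hx : ‖x‖ ≤ R <;> simp [indicator, hx]
    simp_rw [e]
    rw [h]
    simp only [finrank_euclideanSpace, Fintype.card_fin, smul_eq_mul, nsmul_eq_mul]
    have e2 : ∫ y in Ioi (0:ℝ), y ^ (2 - 1) * (Iic R).indicator (fun r => (1 + r ^ 2)⁻¹) y =
        ∫ y in (0:ℝ)..R, y * (1 + y ^ 2)⁻¹ := by
      rw [intervalIntegral.integral_of_le hR]
      have : ∀ y : ℝ, y ^ (2 - 1) * (Iic R).indicator (fun r => (1 + r ^ 2)⁻¹) y =
          (Iic R).indicator (fun y => y * (1 + y ^ 2)⁻¹) y := by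
        intro y
        by_cases hy : y ≤ R <;> simp [indicator, hy]
      simp_rw [this]
      rw [setIntegral_indicator measurableSet_Iic, Ioi_inter_Iic]
    rw [e2]
    have e3 : ∫ y in (0:ℝ)..R, y * (1 + y ^ 2)⁻¹ = 1/2 * Real.log (1 + R ^ 2) := by
      rw [intervalIntegral.integral_eq_sub_of_hasDerivAt
        (f := fun y => 1/2 * Real.log (1 + y ^ 2))]
      · simp
      · intro y _
        have h1 : HasDerivAt (fun y : ℝ => 1 + y ^ 2) (2 * y) y := by
          simpa using (hasDerivAt_pow 2 y).const_add 1
        have := (h1.log (by positivity)).const_mul (1/2)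
        have e : 1 / 2 * (2 * y / (1 + y ^ 2)) = y * (1 + y ^ 2)⁻¹ := by ring
        rw [e] at this
        exact this
      · refine Continuous.intervalIntegrable ?_ _ _
        exact continuous_id.mul (Continuous.inv₀ (by fun_prop) (fun x => by positivity))
    rw [e3]; push_cast; ring

lemma cutoff {K : E2 → ℝ} {δ₀ δ₁ : ℝ} (hK : KerOK K δ₀ δ₁) (R0 : ℝ) {ε : ℝ} (hε : 0 < ε) :
    ∃ η : E2 → ℝ, ContDiff ℝ 2 η ∧ (∀ x, 0 ≤ η x) ∧ (∀ x, η x ≤ 1) ∧ HasCompactSupport η ∧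
      (∀ x, ‖x‖ ≤ R0 → η x = 1) ∧
      ∫ p : E2 × E2, ((η (p.1 + p.2) - η p.1) * (η (p.1 + p.2) - η p.1)) * K p.2
        ∂(volume.prod volume) ≤ ε := by
  obtain ⟨S, hS⟩ := smoothTransition_lip
  set D := 2 * (2 + 2 * δ₀ ^ 2) ^ 2 * (1 + (2 + 2 * δ₀ ^ 2)) with hD
  set m := ∫ z, ‖z‖ ^ 2 * K z with hm
  set vb := (volume : Measure E2).real (ball 0 1) with hvb
  set κ := Real.log (1 + (1 + δ₀) ^ 2) with hκ
  have hδ₀ : 0 ≤ δ₀ := hK.hδ₁.le.trans hK.hδ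
  have hκ0 : 0 ≤ κ := Real.log_nonneg (by nlinarith [sq_nonneg (1 + δ₀)])
  have hm0 : 0 ≤ m := integral_nonneg fun z => mul_nonneg (sq_nonneg _) (hK.nonneg z)
  have hvb0 : 0 ≤ vb := measureReal_nonneg
  have hD0 : 0 ≤ D := by positivity
  set T := (S:ℝ) ^ 2 * D * vb * m * (2 + κ) with hT
  set ρ := max 1 (max (Real.log (1 + R0 ^ 2)) (T / ε)) with hρ
  have hρ1 : 1 ≤ ρ := le_max_left _ _
  have hρ0 : 0 < ρ := by linarith
  have hρ2 : Real.log (1 + R0 ^ 2) ≤ ρ := (le_max_left _ _).trans (le_max_right _ _)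
  have hρ3 : T / ε ≤ ρ := (le_max_right _ _).trans (le_max_right _ _)
  set g : E2 → ℝ := fun x => Real.log (1 + ‖x‖ ^ 2) with hg
  have hgc : ContDiff ℝ 2 g := by
    refine ContDiff.log ?_ (fun x => by positivity)
    exact contDiff_const.add (contDiff_norm_sq ℝ)
  set η : E2 → ℝ := fun x => Real.smoothTransition (2 - g x / ρ) with hη
  have hηc : ContDiff ℝ 2 η := by
    refine (Real.smoothTransition.contDiff (n := 2)).comp ?_
    exact contDiff_const.sub (hgc.div_const ρ)
  have hη0 : ∀ x, Real.exp ρ < ‖x‖ → η x = 0 := by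
    intro x hx
    refine Real.smoothTransition.zero_of_nonpos ?_
    have : 2 * ρ ≤ g x := by
      rw [hg, Real.le_log_iff_exp_le (by positivity)]
      have : Real.exp (2 * ρ) = Real.exp ρ ^ 2 := by rw [← Real.exp_nat_mul]; norm_num
      rw [this]
      nlinarith [Real.exp_pos ρ]
    have : 2 ≤ g x / ρ := by rwa [le_div_iff₀ hρ0]
    linarith
  have hηs : HasCompactSupport η := by
    refine HasCompactSupport.intro (isCompact_closedBall (0:E2) (Real.exp ρ)) fun x hx => ?_
    exact hη0 x (by simpa using hx)
  refine ⟨η, hηc, fun x => Real.smoothTransition.nonneg _, fun x => Real.smoothTransition.le_one _,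
    hηs, ?_, ?_⟩
  · intro x hx
    refine Real.smoothTransition.one_of_one_le ?_
    have : g x ≤ ρ := by
      refine le_trans (Real.log_le_log (by positivity) ?_) hρ2
      have := pow_le_pow_left₀ (norm_nonneg x) hx 2
      linarith
    have : g x / ρ ≤ 1 := by rwa [div_le_one hρ0]
    linarith
  · have hdiff : ∀ x z : E2, ‖z‖ ≤ δ₀ → (η (x + z) - η x) * (η (x + z) - η x) ≤
        (S:ℝ) ^ 2 / ρ ^ 2 * D * ‖z‖ ^ 2 * (1 + ‖x‖ ^ 2)⁻¹ := by
      intro x z hz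
      have h1 : |η (x + z) - η x| ≤ S * |(g (x + z) - g x) / ρ| := by
        have := hS.dist_le_mul (2 - g (x + z) / ρ) (2 - g x / ρ)
        rw [Real.dist_eq, Real.dist_eq] at this
        refine this.trans (le_of_eq ?_)
        congr 1
        rw [← abs_neg]; congr 1; ring
      have h2 := log_diff x z hz
      have h3 : (η (x + z) - η x) ^ 2 ≤ (S * |(g (x + z) - g x) / ρ|) ^ 2 := by
        rw [← sq_abs]
        exact pow_le_pow_left₀ (abs_nonneg _) h1 2
      rw [mul_pow, sq_abs, div_pow] at h3
      calc _ = (η (x + z) - η x) ^ 2 := by ring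
        _ ≤ _ := h3
        _ ≤ (S:ℝ) ^ 2 * ((D * ‖z‖ ^ 2 * (1 + ‖x‖ ^ 2)⁻¹) / ρ ^ 2) := by
            gcongr
        _ = _ := by ring
    obtain ⟨ri, rv⟩ := radial_int (R := Real.exp ρ + δ₀) (by positivity)
    have hmono : ∫ p : E2 × E2, ((η (p.1 + p.2) - η p.1) * (η (p.1 + p.2) - η p.1)) * K p.2
        ∂(volume.prod volume) ≤ ∫ p : E2 × E2, ((S:ℝ) ^ 2 / ρ ^ 2 * D) *
          ((closedBall (0:E2) (Real.exp ρ + δ₀)).indicator (fun x => (1 + ‖x‖ ^ 2)⁻¹) p.1 *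
          (‖p.2‖ ^ 2 * K p.2)) ∂(volume.prod volume) := by
      obtain ⟨B, hB⟩ := lipR_compact (hηc.of_le (by norm_num)) hηs
      refine integral_mono (dd_int hK hB hB hη0) ((ri.mul_prod hK.mom).const_mul _) ?_
      rintro ⟨x, z⟩
      simp only
      by_cases hz : ‖z‖ ≤ δ₀
      · by_cases hx : ‖x‖ ≤ Real.exp ρ + δ₀
        · rw [indicator_of_mem (by simpa using hx)]
          calc _ ≤ _ := mul_le_mul_of_nonneg_right (hdiff x z hz) (hK.nonneg z)
            _ = _ := by ring
        · rw [indicator_of_notMem (by simpa using hx), dd_supp hη0 x z hz (not_le.1 hx)]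
          simp
      · simp [hK.supp z (not_le.1 hz)]
    refine hmono.trans ?_
    rw [integral_const_mul, integral_prod_mul (μ := volume) (ν := volume)
      ((closedBall (0:E2) (Real.exp ρ + δ₀)).indicator (fun x => (1 + ‖x‖ ^ 2)⁻¹))
      (fun z => ‖z‖ ^ 2 * K z), rv, ← hm, ← hvb]
    have hlog : Real.log (1 + (Real.exp ρ + δ₀) ^ 2) ≤ 2 * ρ + κ := by
      have e1 : 1 ≤ Real.exp ρ := Real.one_le_exp hρ0.le
      have e2 : 1 + (Real.exp ρ + δ₀) ^ 2 ≤ Real.exp ρ ^ 2 * (1 + (1 + δ₀) ^ 2) := by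
        have : Real.exp ρ + δ₀ ≤ Real.exp ρ * (1 + δ₀) := by nlinarith
        have := pow_le_pow_left₀ (by positivity) this 2
        nlinarith
      refine (Real.log_le_log (by positivity) e2).trans (le_of_eq ?_)
      rw [Real.log_mul (by positivity) (by positivity), Real.log_pow, Real.log_exp]
      norm_num
      exact hκ.symm
    have hlog2 : Real.log (1 + (Real.exp ρ + δ₀) ^ 2) ≤ (2 + κ) * ρ := by nlinarith
    have hlog0 : 0 ≤ vb * m := by positivity
    calc (S:ℝ) ^ 2 / ρ ^ 2 * D * (vb * Real.log (1 + (Real.exp ρ + δ₀) ^ 2) * m)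
        ≤ (S:ℝ) ^ 2 / ρ ^ 2 * D * (vb * ((2 + κ) * ρ) * m) := by gcongr
      _ = T / ρ := by rw [hT]; field_simp
      _ ≤ ε := by
          rw [div_le_iff₀ hρ0]
          rw [div_le_iff₀ hε] at hρ3
          linarith

lemma inner2 (a b : E2) : inner ℝ a b = a 0 * b 0 + a 1 * b 1 := by
  simp [PiLp.inner_apply, Fin.sum_univ_two, mul_comm]

lemma normsq2 (a : E2) : ‖a‖ ^ 2 = a 0 * a 0 + a 1 * a 1 := by
  rw [← real_inner_self_eq_norm_sq, inner2]

/-- The data used in the geometric argument. -/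
structure Dat (K : E2 → ℝ) (q : E2 → ℝ) (V : E2 → E2) (A M : ℝ) : Prop where
  qc : Continuous q
  smooth : ∀ i, ContDiff ℝ 2 (fun x => V x i)
  lip : ∀ x z, ‖V (x + z) - V x‖ ≤ A * ‖z‖
  bdd : ∀ x, ‖V x‖ ≤ M
  lin : ∀ i φ, ContDiff ℝ 2 φ → HasCompactSupport φ →
    ∫ x, q x * (V x i * φ x) = (1/2) * ∫ p : E2 × E2, ((V (p.1 + p.2) i - V p.1 i) *
        (φ (p.1 + p.2) - φ p.1)) * K p.2 ∂(volume.prod volume)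
  stab : ∀ ζ C, LipR C ζ → HasCompactSupport ζ →
    ∫ x, q x * ζ x ^ 2 ≤ (1/2) * ∫ p : E2 × E2, ((ζ (p.1 + p.2) - ζ p.1) *
        (ζ (p.1 + p.2) - ζ p.1)) * K p.2 ∂(volume.prod volume)

section geom
variable {K : E2 → ℝ} {δ₀ δ₁ : ℝ} {q : E2 → ℝ} {V : E2 → E2} {A M : ℝ}

lemma Dat.lipw (hD : Dat K q V A M) : LipR A (fun x => ‖V x‖) := fun x z =>
  (abs_norm_sub_norm_le _ _).trans (hD.lip x z)

lemma Dat.lipi (hD : Dat K q V A M) (i : Fin 2) : LipR A (fun x => V x i) := by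
  intro x z
  have := PiLp.norm_apply_le (V (x + z) - V x) i
  simp only [PiLp.sub_apply, Real.norm_eq_abs] at this
  exact this.trans (hD.lip x z)

lemma Dat.contV (hD : Dat K q V A M) : Continuous V := by
  have h : LipschitzWith ⟨A, hD.lipw.nonneg⟩ V := by
    refine LipschitzWith.of_dist_le_mul fun x y => ?_
    have := hD.lip y (x - y)
    rw [add_sub_cancel] at this
    rw [dist_eq_norm, dist_eq_norm]
    exact this
  exact h.continuous

lemma int_lin3 {X : Type*} [MeasurableSpace X] {μ : Measure X} {f1 f2 f3 : X → ℝ}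
    (h1 : Integrable f1 μ) (h2 : Integrable f2 μ) (h3 : Integrable f3 μ) (c d : ℝ) :
    Integrable (fun p => f1 p + c * f2 p + d * f3 p) μ ∧
    ∫ p, (f1 p + c * f2 p + d * f3 p) ∂μ = ∫ p, f1 p ∂μ + c * ∫ p, f2 p ∂μ + d * ∫ p, f3 p ∂μ := by
  have h12 : Integrable (fun p => f1 p + c * f2 p) μ := h1.add (h2.const_mul c)
  refine ⟨h12.add (h3.const_mul d), ?_⟩
  rw [integral_add h12 (h3.const_mul d), integral_add h1 (h2.const_mul c), integral_const_mul,
    integral_const_mul]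

lemma int_lin5 {X : Type*} [MeasurableSpace X] {μ : Measure X} {f1 f2 f3 f4 f5 : X → ℝ}
    (h1 : Integrable f1 μ) (h2 : Integrable f2 μ) (h3 : Integrable f3 μ) (h4 : Integrable f4 μ)
    (h5 : Integrable f5 μ) (c d : ℝ) :
    Integrable (fun p => c * f1 p + f2 p + f3 p - f4 p - d * f5 p) μ ∧
    ∫ p, (c * f1 p + f2 p + f3 p - f4 p - d * f5 p) ∂μ =
      c * ∫ p, f1 p ∂μ + ∫ p, f2 p ∂μ + ∫ p, f3 p ∂μ - ∫ p, f4 p ∂μ - d * ∫ p, f5 p ∂μ := by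
  have h12 : Integrable (fun p => c * f1 p + f2 p) μ := (h1.const_mul c).add h2
  have h123 : Integrable (fun p => c * f1 p + f2 p + f3 p) μ := h12.add h3
  have h1234 : Integrable (fun p => c * f1 p + f2 p + f3 p - f4 p) μ := h123.sub h4
  refine ⟨h1234.sub (h5.const_mul d), ?_⟩
  rw [integral_sub h1234 (h5.const_mul d), integral_sub h123 h4, integral_add h12 h3,
    integral_add (h1.const_mul c) h2, integral_const_mul, integral_const_mul]

set_option maxHeartbeats 2000000 in
lemma main_ineq (hK : KerOK K δ₀ δ₁) (hD : Dat K q V A M) {η ψ : E2 → ℝ} {B t : ℝ}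
    (hη : ContDiff ℝ 2 η) (hηs : HasCompactSupport η)
    (hψ : LipR B ψ) (hψs : HasCompactSupport ψ) (hwψ : ∀ x, ‖V x‖ * ψ x = 0)
    {F : E2 × E2 → ℝ} (hFi : Integrable (fun p => F p * K p.2) (volume.prod volume))
    (hF : ∀ x z, ‖z‖ ≤ δ₀ → F (x, z) ≤
      (‖V (x + z)‖ * ‖V x‖ - inner ℝ (V (x + z)) (V x)) * (η x ^ 2 + η (x + z) ^ 2) -
      2 * t * ((‖V (x + z)‖ * η (x + z) - ‖V x‖ * η x) * (ψ (x + z) - ψ x))) :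
    ∫ p, F p * K p.2 ∂(volume.prod volume) + 2 * t ^ 2 * ∫ x, q x * ψ x ^ 2 ≤
      M ^ 2 * (∫ p : E2 × E2, ((η (p.1 + p.2) - η p.1) * (η (p.1 + p.2) - η p.1)) * K p.2
        ∂(volume.prod volume)) + t ^ 2 * ∫ p : E2 × E2, ((ψ (p.1 + p.2) - ψ p.1) *
          (ψ (p.1 + p.2) - ψ p.1)) * K p.2 ∂(volume.prod volume) := by
  obtain ⟨N, hN⟩ := lipR_compact (hη.of_le (by norm_num)) hηs
  obtain ⟨Rη, hRη⟩ := supp_bd hηs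
  obtain ⟨Rψ, hRψ⟩ := supp_bd hψs
  obtain ⟨Bη, hBη⟩ := hη.continuous.bounded_above_of_compact_support hηs
  have hM0 : 0 ≤ M := (norm_nonneg _).trans (hD.bdd 0)
  -- Lipschitz bound of w η
  set a : E2 → ℝ := fun x => ‖V x‖ * η x with ha
  have haL : LipR (M * N + Bη * A) a := by
    intro x z
    have e : a (x + z) - a x = ‖V (x + z)‖ * (η (x + z) - η x) +
      η x * (‖V (x + z)‖ - ‖V x‖) := by simp only [ha]; ring
    rw [e]
    refine (abs_add_le _ _).trans ?_
    rw [abs_mul, abs_mul, abs_norm, add_mul, mul_assoc, mul_assoc]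
    refine add_le_add ?_ ?_
    · exact mul_le_mul (hD.bdd _) (hN x z) (abs_nonneg _) hM0
    · exact mul_le_mul (hBη x) (hD.lipw x z) (abs_nonneg _)
        ((norm_nonneg _).trans (hBη x))
  have has : HasCompactSupport a := hηs.mul_left
  have haR : ∀ x, Rη < ‖x‖ → a x = 0 := fun x hx => by simp [ha, hRη x hx]
  set ζ : E2 → ℝ := fun x => a x + t * ψ x with hζ
  have hζL : LipR ((M * N + Bη * A) + |t| * B) ζ := by
    intro x z
    have e : ζ (x + z) - ζ x = (a (x + z) - a x) + t * (ψ (x + z) - ψ x) := by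
      simp only [hζ]; ring
    rw [e]
    refine (abs_add_le _ _).trans ?_
    rw [abs_mul, add_mul _ (|t| * B), mul_assoc |t|]
    exact add_le_add (haL x z) (mul_le_mul_of_nonneg_left (hψ x z) (abs_nonneg _))
  have hζs : HasCompactSupport ζ := has.add hψs.mul_left
  have hst := hD.stab ζ _ hζL hζs
  have hVc := hD.contV
  have hwc : Continuous fun x => ‖V x‖ := hVc.norm
  -- left side of the stability inequality
  have hl : ∫ x, q x * ζ x ^ 2 = (∫ x, q x * a x ^ 2) + t ^ 2 * ∫ x, q x * ψ x ^ 2 := by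
    rw [← integral_const_mul, ← integral_add]
    · congr 1; ext x
      have h0 : a x * ψ x = 0 := by
        simp only [ha]
        linear_combination η x * hwψ x
      simp only [hζ]
      linear_combination 2 * t * q x * h0
    · refine Continuous.integrable_of_hasCompactSupport
        (hD.qc.mul (haL.cont.pow 2)) ?_
      have : (fun x => q x * a x ^ 2) = fun x => (q x * a x) * a x := by ext x; ring
      rw [this]; exact has.mul_left
    · refine (Continuous.integrable_of_hasCompactSupport
        (hD.qc.mul (hψ.cont.pow 2)) ?_).const_mul _
      have : (fun x => q x * ψ x ^ 2) = fun x => (q x * ψ x) * ψ x := by ext x; ring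
      change HasCompactSupport (fun x => q x * ψ x ^ 2)
      rw [this]; exact hψs.mul_left
  -- linearised equation
  set φ : Fin 2 → E2 → ℝ := fun i x => V x i * η x ^ 2 with hφ
  have hφc : ∀ i, ContDiff ℝ 2 (φ i) := fun i => (hD.smooth i).mul (hη.pow 2)
  have hφs : ∀ i, HasCompactSupport (φ i) := fun i => by
    have : φ i = fun x => (V x i * η x) * η x := by ext x; simp only [hφ]; ring
    rw [this]; exact hηs.mul_left
  have hφR : ∀ i x, Rη < ‖x‖ → φ i x = 0 := fun i x hx => by simp [hφ, hRη x hx]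
  have hlin := fun i => hD.lin i (φ i) (hφc i) (hφs i)
  have hq : ∫ x, q x * a x ^ 2 =
      (∫ x, q x * (V x 0 * φ 0 x)) + ∫ x, q x * (V x 1 * φ 1 x) := by
    have hi : ∀ i, Integrable (fun x => q x * (V x i * φ i x)) volume := fun i =>
      Continuous.integrable_of_hasCompactSupport
        (hD.qc.mul ((hD.smooth i).continuous.mul (hφc i).continuous))
        ((hφs i).mul_left.mul_left)
    rw [← integral_add (hi 0) (hi 1)]
    congr 1; ext x
    have := normsq2 (V x)
    simp only [ha, hφ]
    linear_combination q x * η x ^ 2 * this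
  have hIi : ∀ i, Integrable (fun p : E2 × E2 => ((V (p.1 + p.2) i - V p.1 i) *
      (φ i (p.1 + p.2) - φ i p.1)) * K p.2) (volume.prod volume) := fun i => by
    obtain ⟨C, hC⟩ := lipR_compact ((hφc i).of_le (by norm_num)) (hφs i)
    exact dd_int hK (hD.lipi i) hC (hφR i)
  have haa := dd_int hK haL haL haR
  have hab := dd_int hK haL hψ hRψ
  have hbb := dd_int hK hψ hψ hRψ
  have hee := dd_int hK hN hN hRη
  have hζζ : ∫ p : E2 × E2, ((ζ (p.1 + p.2) - ζ p.1) * (ζ (p.1 + p.2) - ζ p.1)) * K p.2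
      ∂(volume.prod volume) =
      (∫ p : E2 × E2, ((a (p.1 + p.2) - a p.1) * (a (p.1 + p.2) - a p.1)) * K p.2
        ∂(volume.prod volume)) +
      2 * t * (∫ p : E2 × E2, ((a (p.1 + p.2) - a p.1) * (ψ (p.1 + p.2) - ψ p.1)) * K p.2
        ∂(volume.prod volume)) +
      t ^ 2 * (∫ p : E2 × E2, ((ψ (p.1 + p.2) - ψ p.1) * (ψ (p.1 + p.2) - ψ p.1)) * K p.2
        ∂(volume.prod volume)) := by
    rw [← (int_lin3 haa hab hbb (2 * t) (t ^ 2)).2]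
    congr 1; ext p
    simp only [hζ]; ring
  have hmono : ∫ p, F p * K p.2 ∂(volume.prod volume) ≤
      M ^ 2 * (∫ p : E2 × E2, ((η (p.1 + p.2) - η p.1) * (η (p.1 + p.2) - η p.1)) * K p.2
        ∂(volume.prod volume)) +
      (∫ p : E2 × E2, ((V (p.1 + p.2) 0 - V p.1 0) *
      (φ 0 (p.1 + p.2) - φ 0 p.1)) * K p.2 ∂(volume.prod volume)) +
      (∫ p : E2 × E2, ((V (p.1 + p.2) 1 - V p.1 1) *
      (φ 1 (p.1 + p.2) - φ 1 p.1)) * K p.2 ∂(volume.prod volume)) -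
      (∫ p : E2 × E2, ((a (p.1 + p.2) - a p.1) * (a (p.1 + p.2) - a p.1)) * K p.2
        ∂(volume.prod volume)) -
      2 * t * (∫ p : E2 × E2, ((a (p.1 + p.2) - a p.1) * (ψ (p.1 + p.2) - ψ p.1)) * K p.2
        ∂(volume.prod volume)) := by
    have h5 := int_lin5 hee (hIi 0) (hIi 1) haa hab (M ^ 2) (2 * t)
    rw [← h5.2]
    refine integral_mono hFi h5.1 ?_
    rintro ⟨x, z⟩
    simp only
    by_cases hz : ‖z‖ ≤ δ₀
    · have h1 := hF x z hz
      have h2 : ‖V (x + z)‖ * ‖V x‖ ≤ M ^ 2 := by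
        rw [sq]; exact mul_le_mul (hD.bdd _) (hD.bdd _) (norm_nonneg _) hM0
      have h3 := mul_le_mul_of_nonneg_right h2 (sq_nonneg (η (x + z) - η x))
      have n1 := normsq2 (V x)
      have n2 := normsq2 (V (x + z))
      have n3 := inner2 (V (x + z)) (V x)
      have key : F (x, z) ≤ M ^ 2 * ((η (x + z) - η x) * (η (x + z) - η x)) +
          (V (x + z) 0 - V x 0) * (φ 0 (x + z) - φ 0 x) +
          (V (x + z) 1 - V x 1) * (φ 1 (x + z) - φ 1 x) -
          (a (x + z) - a x) * (a (x + z) - a x) -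
          2 * t * ((a (x + z) - a x) * (ψ (x + z) - ψ x)) := by
        rw [n3] at h1
        refine h1.trans ?_
        simp only [ha, hφ]
        generalize ‖V (x + z)‖ = w' at *
        generalize ‖V x‖ = w at *
        have e : (V (x + z) 0 - V x 0) * (V (x + z) 0 * η (x + z) ^ 2 - V x 0 * η x ^ 2) +
          (V (x + z) 1 - V x 1) * (V (x + z) 1 * η (x + z) ^ 2 - V x 1 * η x ^ 2) =
          w' ^ 2 * η (x + z) ^ 2 + w ^ 2 * η x ^ 2 -
          (V (x + z) 0 * V x 0 + V (x + z) 1 * V x 1) * (η x ^ 2 + η (x + z) ^ 2) := by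
          rw [n1, n2]; ring
        linarith
      calc _ ≤ _ := mul_le_mul_of_nonneg_right key (hK.nonneg z)
        _ = _ := by ring
    · simp [hK.supp z (not_le.1 hz)]
  rw [hl, hq, hlin 0, hlin 1, hζζ] at hst
  linarith

lemma pos_zero (hK : KerOK K δ₀ δ₁) {F : E2 × E2 → ℝ} (hF : Continuous F) (hF0 : ∀ p, 0 ≤ F p)
    (hFi : Integrable (fun p => F p * K p.2) (volume.prod volume))
    (hI : ∫ p, F p * K p.2 ∂(volume.prod volume) ≤ 0) (x z : E2) (hz : z ≠ 0)
    (hz1 : ‖z‖ < δ₁) : F (x, z) = 0 := by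
  have hnn : 0 ≤ fun p : E2 × E2 => F p * K p.2 := fun p => mul_nonneg (hF0 p) (hK.nonneg _)
  have h0 := (integral_eq_zero_iff_of_nonneg hnn hFi).1 (le_antisymm hI (integral_nonneg hnn))
  have hO : IsOpen {p : E2 × E2 | 0 < F p ∧ p.2 ≠ 0 ∧ ‖p.2‖ < δ₁} :=
    (isOpen_lt continuous_const hF).inter
      ((isOpen_ne_fun continuous_snd continuous_const).inter
        (isOpen_lt continuous_snd.norm continuous_const))
  have hm : (volume.prod volume : Measure (E2 × E2))
      {p : E2 × E2 | 0 < F p ∧ p.2 ≠ 0 ∧ ‖p.2‖ < δ₁} = 0 := by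
    refine measure_mono_null ?_ (ae_iff.1 h0)
    rintro p ⟨h1, h2, h3⟩
    exact (mul_pos h1 (hK.pos _ h2 h3)).ne'
  rw [hO.measure_eq_zero_iff (volume.prod volume : Measure (E2 × E2))] at hm
  by_contra h
  have : (x, z) ∈ {p : E2 × E2 | 0 < F p ∧ p.2 ≠ 0 ∧ ‖p.2‖ < δ₁} :=
    ⟨lt_of_le_of_ne (hF0 _) (Ne.symm h), hz, hz1⟩
  rw [hm] at this
  exact this

/-- hat function -/
lemma hat_props (x0 : E2) {r : ℝ} (hr : 0 < r) : LipR 1 (fun x : E2 => max 0 (r - ‖x - x0‖)) ∧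
    HasCompactSupport (fun x : E2 => max 0 (r - ‖x - x0‖)) := by
  constructor
  · intro x z
    have h1 : |‖x + z - x0‖ - ‖x - x0‖| ≤ ‖z‖ := by
      have := abs_norm_sub_norm_le (x + z - x0) (x - x0)
      rwa [show x + z - x0 - (x - x0) = z by abel] at this
    rw [one_mul]
    refine (abs_max_sub_max_le_max _ _ _ _).trans ?_
    simp only [sub_self, abs_zero]
    refine max_le (norm_nonneg z) ?_
    rw [abs_sub_comm] at h1
    have e : r - ‖x + z - x0‖ - (r - ‖x - x0‖) = ‖x - x0‖ - ‖x + z - x0‖ := by ring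
    rw [e]; exact h1
  · refine HasCompactSupport.intro (isCompact_closedBall x0 r) fun x hx => ?_
    have : r < ‖x - x0‖ := by simpa [dist_eq_norm] using hx
    exact max_eq_left (by linarith)

lemma aligned (hK : KerOK K δ₀ δ₁) (hD : Dat K q V A M) (x z : E2) (hz : ‖z‖ < δ₁) :
    inner ℝ (V (x + z)) (V x) = ‖V (x + z)‖ * ‖V x‖ := by
  by_cases hz0 : z = 0
  · simp [hz0, real_inner_self_eq_norm_sq, sq]
  obtain ⟨hb, hbs⟩ := hat_props x (r := 1) one_pos
  set b : E2 → ℝ := fun y => max 0 (1 - ‖y - x‖) with hbd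
  have hb0 : ∀ y, 0 ≤ b y := fun y => le_max_left _ _
  have hb1 : ∀ y, b y ≤ 1 := fun y => max_le zero_le_one (by linarith [norm_nonneg (y - x)])
  obtain ⟨R, hR⟩ := supp_bd hbs
  have hVc := hD.contV
  set F : E2 × E2 → ℝ := fun p =>
    b p.1 * (‖V (p.1 + p.2)‖ * ‖V p.1‖ - inner ℝ (V (p.1 + p.2)) (V p.1)) with hFd
  have hFc : Continuous F := by
    have := hb.cont
    simp only [hFd]
    fun_prop
  have hdef : ∀ x z, 0 ≤ ‖V (x + z)‖ * ‖V x‖ - inner ℝ (V (x + z)) (V x) := fun x z =>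
    sub_nonneg.2 (real_inner_le_norm _ _)
  have hF0 : ∀ p, 0 ≤ F p := fun p => mul_nonneg (hb0 _) (hdef _ _)
  have hFi : Integrable (fun p => F p * K p.2) (volume.prod volume) := by
    refine hK.int hFc (C := A ^ 2) (R := R) ?_ ?_
    · intro x z _
      rw [abs_of_nonneg (hF0 _)]
      have h1 : ‖V (x + z)‖ * ‖V x‖ - inner ℝ (V (x + z)) (V x) ≤ A ^ 2 * ‖z‖ ^ 2 := by
        have e := norm_sub_sq_real (V (x + z)) (V x)
        have h2 : ‖V (x + z) - V x‖ ^ 2 ≤ (A * ‖z‖) ^ 2 :=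
          pow_le_pow_left₀ (norm_nonneg _) (hD.lip x z) 2
        nlinarith [sq_nonneg (‖V (x + z)‖ - ‖V x‖), sq_nonneg (‖V (x + z) - V x‖)]
      calc F (x, z) ≤ 1 * (‖V (x + z)‖ * ‖V x‖ - inner ℝ (V (x + z)) (V x)) :=
            mul_le_mul_of_nonneg_right (hb1 x) (hdef x z)
        _ ≤ _ := by rw [one_mul]; exact h1
    · intro x z _ hx
      simp [hFd, hR x hx]
  have hI : ∫ p, F p * K p.2 ∂(volume.prod volume) ≤ 0 := by
    refine le_of_forall_pos_le_add fun ε hε => ?_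
    obtain ⟨η, h1, h2, h3, h4, h5, h6⟩ := cutoff hK R (ε := ε / (M ^ 2 + 1)) (by positivity)
    have := main_ineq hK hD (ψ := fun _ => 0) (B := 0) (t := 0) h1 h4
      (fun x z => by simp) (HasCompactSupport.zero) (fun x => by simp) hFi (fun x z _ => by
        simp only [hFd, mul_zero, zero_mul, sub_zero]
        rw [mul_comm]
        refine mul_le_mul_of_nonneg_left ?_ (hdef x z)
        by_cases hx : ‖x‖ ≤ R
        · rw [h5 x hx]; nlinarith [hb1 x, sq_nonneg (η (x + z))]
        · rw [hR x (not_le.1 hx)]; positivity)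
    simp only [ne_eq, OfNat.ofNat_ne_zero, not_false_eq_true, zero_pow, mul_zero, zero_mul,
      add_zero] at this
    refine this.trans ?_
    rw [zero_add]
    calc _ ≤ M ^ 2 * (ε / (M ^ 2 + 1)) := mul_le_mul_of_nonneg_left h6 (sq_nonneg _)
      _ ≤ ε := by
        rw [← mul_div_assoc, div_le_iff₀ (by positivity)]
        nlinarith
  have := pos_zero hK hFc hF0 hFi hI x z hz0 hz
  simp only [hFd, hbd] at this
  simp at this
  linarith

lemma vanish (hK : KerOK K δ₀ δ₁) (hD : Dat K q V A M) (x0 : E2) {r : ℝ} (hr : 0 < r)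
    (hV : ∀ x ∈ ball x0 r, V x = 0) : ∀ x ∈ ball x0 δ₁, V x = 0 := by
  intro x hx
  by_cases hx0 : x = x0
  · rw [hx0]; exact hV x0 (mem_ball_self hr)
  obtain ⟨hψ, hψs⟩ := hat_props x0 hr
  set ψ : E2 → ℝ := fun y => max 0 (r - ‖y - x0‖) with hψd
  have hψ0 : ∀ y, 0 ≤ ψ y := fun y => le_max_left _ _
  obtain ⟨R, hR⟩ := supp_bd hψs
  have hVc := hD.contV
  have hwψ : ∀ x, ‖V x‖ * ψ x = 0 := by
    intro y
    by_cases hy : y ∈ ball x0 r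
    · simp [hV y hy]
    · have : r ≤ ‖y - x0‖ := by simpa [dist_eq_norm] using hy
      have : ψ y = 0 := max_eq_left (by linarith)
      rw [this, mul_zero]
  set F : E2 × E2 → ℝ := fun p => ‖V (p.1 + p.2)‖ * ψ p.1 with hFd
  have hFc : Continuous F := by
    have := hψ.cont
    simp only [hFd]
    fun_prop
  have hF0 : ∀ p, 0 ≤ F p := fun p => mul_nonneg (norm_nonneg _) (hψ0 _)
  have hδ₀ : 0 ≤ δ₀ := hK.hδ₁.le.trans hK.hδ
  have hFi : Integrable (fun p => F p * K p.2) (volume.prod volume) := by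
    refine hK.int hFc (C := A * 1) (R := R) ?_ ?_
    · intro x z _
      rw [abs_of_nonneg (hF0 _)]
      have h := (neg_le_abs _).trans (dd_bd hD.lipw hψ x z)
      refine le_trans (le_of_sub_nonneg ?_) h
      simp only [hFd]
      nlinarith [hwψ x, hwψ (x + z), mul_nonneg (norm_nonneg (V x)) (hψ0 (x + z))]
    · intro x z _ hx
      simp [hFd, hR x hx]
  set c1 := ∫ x, q x * ψ x ^ 2
  set c2 := ∫ p : E2 × E2, ((ψ (p.1 + p.2) - ψ p.1) *
          (ψ (p.1 + p.2) - ψ p.1)) * K p.2 ∂(volume.prod volume)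
  set I := ∫ p, F p * K p.2 ∂(volume.prod volume) with hId
  have hI : I ≤ 0 := by
    have step : ∀ t : ℝ, 0 < t → 2 * t * I + 2 * t ^ 2 * c1 ≤ t ^ 2 * c2 := by
      intro t ht
      refine le_of_forall_pos_le_add fun ε hε => ?_
      obtain ⟨η, h1, h2, h3, h4, h5, h6⟩ :=
        cutoff hK (R + δ₀) (ε := ε / (M ^ 2 + 1)) (by positivity)
      have hFi' : Integrable (fun p : E2 × E2 => (2 * t * F p) * K p.2) (volume.prod volume) := by
        simp_rw [mul_assoc]
        exact (hFi.const_mul _).const_mul _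
      have := main_ineq hK hD (ψ := ψ) (t := t) (F := fun p => 2 * t * F p) h1 h4
        hψ hψs hwψ hFi' (fun x z hz => by
          have hd : 0 ≤ ‖V (x + z)‖ * ‖V x‖ - inner ℝ (V (x + z)) (V x) :=
            sub_nonneg.2 (real_inner_le_norm _ _)
          have hd2 := mul_nonneg hd (by positivity : 0 ≤ η x ^ 2 + η (x + z) ^ 2)
          have key : F (x, z) ≤
              -((‖V (x + z)‖ * η (x + z) - ‖V x‖ * η x) * (ψ (x + z) - ψ x)) := by
            have e : -((‖V (x + z)‖ * η (x + z) - ‖V x‖ * η x) * (ψ (x + z) - ψ x)) =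
                ‖V (x + z)‖ * ψ x * η (x + z) + ‖V x‖ * η x * ψ (x + z) := by
              linear_combination (-η (x + z)) * hwψ (x + z) - η x * hwψ x
            rw [e]
            have p1 : 0 ≤ ‖V x‖ * η x * ψ (x + z) :=
              mul_nonneg (mul_nonneg (norm_nonneg _) (h2 x)) (hψ0 _)
            have p2 : ‖V (x + z)‖ * ψ x * η (x + z) = F (x, z) := by
              by_cases hxR : ‖x‖ ≤ R
              · rw [h5 (x + z) ((norm_add_le x z).trans (by linarith)), mul_one]
              · simp [hFd, hR x (not_le.1 hxR)]
            linarith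
          have := mul_le_mul_of_nonneg_left key (by positivity : 0 ≤ 2 * t)
          linarith)
      have e : ∫ p, (2 * t * F p) * K p.2 ∂(volume.prod volume) = 2 * t * I := by
        rw [hId, ← integral_const_mul]
        congr 1; ext p; ring
      rw [e] at this
      have h7 : M ^ 2 * (∫ p : E2 × E2, ((η (p.1 + p.2) - η p.1) * (η (p.1 + p.2) - η p.1)) * K p.2
        ∂(volume.prod volume)) ≤ ε := by
        calc _ ≤ M ^ 2 * (ε / (M ^ 2 + 1)) := mul_le_mul_of_nonneg_left h6 (sq_nonneg _)
          _ ≤ ε := by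
            rw [← mul_div_assoc, div_le_iff₀ (by positivity)]
            nlinarith
      linarith
    by_contra hpos
    push Not at hpos
    set c := |c2 - 2 * c1| + 1 with hc
    have hcpos : 0 < c := by positivity
    have h1 := step (I / c) (by positivity)
    have h2 : c2 - 2 * c1 ≤ c := by linarith [le_abs_self (c2 - 2 * c1)]
    have h3 : 2 * (I / c) * I ≤ (I / c) ^ 2 * c := by
      nlinarith [mul_le_mul_of_nonneg_left h2 (sq_nonneg (I / c))]
    have h4 : (I / c) ^ 2 * c = (I / c) * I := by field_simp
    have h5 : 0 < (I / c) * I := by positivity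
    linarith
  have hxd : ‖x - x0‖ < δ₁ := by simpa [dist_eq_norm] using hx
  have := pos_zero hK hFc hF0 hFi hI x0 (x - x0) (sub_ne_zero.2 hx0) hxd
  simp only [hFd, hψd, add_sub_cancel, sub_self, norm_zero, sub_zero] at this
  rw [max_eq_right hr.le] at this
  simpa [hr.ne'] using this

end geom

lemma mom_one {α δ₀ Lam : ℝ} (hδ₀ : 0 < δ₀) (hα : α < 2) :
    Integrable (fun z : E2 => Lam * ‖z‖ ^ (-α) * (if ‖z‖ ≤ δ₀ then 1 else 0)) volume := by
  rw [integrable_fun_norm_addHaar (volume : Measure E2)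
    (f := fun y => Lam * y ^ (-α) * (if y ≤ δ₀ then 1 else 0))]
  have h1 : IntegrableOn (fun x : ℝ => x ^ (1 - α)) (Ioo 0 δ₀) volume :=
    (intervalIntegral.integrableOn_Ioo_rpow_iff hδ₀).2 (by linarith)
  have h2 : IntegrableOn (fun x : ℝ => Lam * x ^ (1 - α)) (Ioc 0 δ₀) volume := by
    rw [integrableOn_Ioc_iff_integrableOn_Ioo]
    exact h1.const_mul _
  have h3 : Integrable ((Ioc 0 δ₀).indicator (fun x : ℝ => Lam * x ^ (1 - α))) volume :=
    (integrable_indicator_iff measurableSet_Ioc).2 h2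
  refine (h3.integrableOn (s := Ioi 0)).congr_fun ?_ measurableSet_Ioi
  intro y hy
  have hy0 : (0:ℝ) < y := hy
  simp only [finrank_euclideanSpace, Fintype.card_fin, smul_eq_mul]
  by_cases h : y ≤ δ₀
  · rw [indicator_of_mem (show y ∈ Ioc 0 δ₀ from ⟨hy0, h⟩), if_pos h,
      show (1:ℝ) - α = 1 + -α by ring, Real.rpow_add hy0, Real.rpow_one]
    norm_num
    ring
  · rw [indicator_of_notMem (fun hh => h hh.2), if_neg h]
    simp

lemma up_one {α δ₀ Lam : ℝ} {J : E2 → ℝ} {z : E2} (hz : z ≠ 0)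
    (h : J z ≤ Lam * ‖z‖ ^ (-(2:ℝ) - α) * (if ‖z‖ ≤ δ₀ then 1 else 0)) :
    ‖z‖ ^ 2 * J z ≤ Lam * ‖z‖ ^ (-α) * (if ‖z‖ ≤ δ₀ then 1 else 0) := by
  have hz0 : 0 < ‖z‖ := norm_pos_iff.2 hz
  calc _ ≤ ‖z‖ ^ 2 * (Lam * ‖z‖ ^ (-(2:ℝ) - α) * (if ‖z‖ ≤ δ₀ then 1 else 0)) :=
        mul_le_mul_of_nonneg_left h (by positivity)
    _ = _ := by
      rw [show -α = 2 + (-(2:ℝ) - α) by ring, Real.rpow_add hz0 2, Real.rpow_two]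
      ring_nf

/-- The kernel redefined at the origin. -/
def normK (J₁ J₂ : E2 → ℝ) : E2 → ℝ := fun z => if z = 0 then 0 else J₁ z + J₂ z

lemma kerOK_norm (J₁ J₂ : E2 → ℝ)
    (hJ₁meas : Measurable J₁) (hJ₂meas : Measurable J₂)
    (hJ₁nonneg : ∀ z, z ≠ 0 → 0 ≤ J₁ z) (hJ₂nonneg : ∀ z, z ≠ 0 → 0 ≤ J₂ z)
    (hJ₁even : ∀ z, z ≠ 0 → J₁ (-z) = J₁ z) (hJ₂even : ∀ z, z ≠ 0 → J₂ (-z) = J₂ z)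
    (δ₀ δ₁ lam Lam α₁ α₂ β₁ : ℝ) (hδ₁ : 0 < δ₁) (hδ : δ₁ ≤ δ₀)
    (hlam : 0 < lam) (hα₁2 : α₁ < 2) (hα₂2 : α₂ < 2)
    (hJ₁low : ∀ z, z ≠ 0 → lam * ‖z‖ ^ (-(2:ℝ) - β₁) * (if ‖z‖ ≤ δ₁ then 1 else 0) ≤ J₁ z)
    (hJ₁up : ∀ z, z ≠ 0 → J₁ z ≤ Lam * ‖z‖ ^ (-(2:ℝ) - α₁) * (if ‖z‖ ≤ δ₀ then 1 else 0))
    (hJ₂up : ∀ z, z ≠ 0 → J₂ z ≤ Lam * ‖z‖ ^ (-(2:ℝ) - α₂) * (if ‖z‖ ≤ δ₀ then 1 else 0)) :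
    KerOK (normK J₁ J₂) δ₀ δ₁ := by
  have hmeas : Measurable (normK J₁ J₂) :=
    Measurable.ite (measurableSet_singleton (0:E2)) measurable_const (hJ₁meas.add hJ₂meas)
  have hnn : ∀ z, 0 ≤ normK J₁ J₂ z := by
    intro z
    unfold normK
    split_ifs with h
    · exact le_rfl
    · exact add_nonneg (hJ₁nonneg z h) (hJ₂nonneg z h)
  have hδ₀ : 0 < δ₀ := hδ₁.trans_le hδ
  refine ⟨hmeas, hnn, ?_, ?_, ?_, ?_, hδ₁, hδ⟩
  · intro z
    unfold normK
    by_cases h : z = 0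
    · simp [h]
    · rw [if_neg (neg_ne_zero.2 h), if_neg h, hJ₁even z h, hJ₂even z h]
  · have hm : Measurable fun z : E2 => ‖z‖ ^ 2 * normK J₁ J₂ z :=
      (measurable_norm.pow_const 2).mul hmeas
    refine ((mom_one (Lam := Lam) hδ₀ hα₁2).add (mom_one (Lam := Lam) hδ₀ hα₂2)).mono'
      hm.aestronglyMeasurable ?_
    have hae : ∀ᵐ z : E2 ∂volume, z ≠ 0 := by
      simp [ae_iff]
    filter_upwards [hae] with z hz
    rw [Real.norm_eq_abs, abs_of_nonneg (mul_nonneg (by positivity) (hnn z))]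
    simp only [Pi.add_apply, normK, if_neg hz, mul_add]
    exact add_le_add (up_one hz (hJ₁up z hz)) (up_one hz (hJ₂up z hz))
  · intro z hz
    have h0 : z ≠ 0 := norm_pos_iff.1 (hδ₀.trans hz)
    have h1 := hJ₁up z h0
    have h2 := hJ₂up z h0
    rw [if_neg (not_le.2 hz), mul_zero] at h1 h2
    simp only [normK, if_neg h0]
    linarith [hJ₁nonneg z h0, hJ₂nonneg z h0]
  · intro z h0 hz
    have h1 := hJ₁low z h0
    rw [if_pos hz.le, mul_one] at h1
    have h2 : 0 < lam * ‖z‖ ^ (-(2:ℝ) - β₁) :=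
      mul_pos hlam (Real.rpow_pos_of_pos (norm_pos_iff.2 h0) _)
    simp only [normK, if_neg h0]
    linarith [hJ₂nonneg z h0]

lemma hasPV_norm {J₁ J₂ u : E2 → ℝ} {x : E2} {l : ℝ}
    (h : HasPV (fun z => J₁ z + J₂ z) u x l) : HasPV (normK J₁ J₂) u x l := by
  refine Tendsto.congr' ?_ h
  filter_upwards [self_mem_nhdsWithin] with ε hε
  have hε0 : (0:ℝ) < ε := hε
  refine setIntegral_congr_fun (measurableSet_lt measurable_const
    (measurable_const.dist measurable_id)) ?_
  intro y hy
  have hy' : ε < dist x y := hy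
  have : x - y ≠ 0 := sub_ne_zero.2 (dist_pos.1 (hε0.trans hy'))
  simp only [normK, if_neg this]

lemma geom_final {K : E2 → ℝ} {δ₀ δ₁ : ℝ} {q : E2 → ℝ} {V : E2 → E2} {A M : ℝ}
    (hK : KerOK K δ₀ δ₁) (hD : Dat K q V A M) :
    (∀ x, V x = 0) ∨ ∃ ν : E2, ‖ν‖ = 1 ∧ ∀ x, V x = ‖V x‖ • ν := by
  have hδ := hK.hδ₁
  by_cases hZint : (interior {x | V x = 0}).Nonempty
  · left
    have hcl : IsClopen (interior {x | V x = 0}) := by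
      refine ⟨?_, isOpen_interior⟩
      rw [← closure_subset_iff_isClosed]
      intro x hx
      rw [Metric.mem_closure_iff] at hx
      obtain ⟨y, hy, hxy⟩ := hx δ₁ hδ
      obtain ⟨r, hr, hb⟩ := Metric.isOpen_iff.1 isOpen_interior y hy
      have hv := vanish hK hD y hr (fun w hw => (interior_subset (s := {x | V x = 0}) (hb hw) :))
      rw [mem_interior]
      exact ⟨ball y δ₁, hv, isOpen_ball, hxy⟩
    have hu := hcl.eq_univ hZint
    intro x
    have : x ∈ interior {x | V x = 0} := hu ▸ mem_univ x
    exact (interior_subset (s := {x | V x = 0}) this :)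
  · right
    rw [not_nonempty_iff_eq_empty] at hZint
    have hdense : ∀ O : Set E2, IsOpen O → O.Nonempty → ∃ p ∈ O, V p ≠ 0 := by
      intro O hO hne
      by_contra hcon
      push Not at hcon
      obtain ⟨p, hp⟩ := hne
      have : p ∈ interior {x | V x = 0} := mem_interior.2 ⟨O, hcon, hO, hp⟩
      rw [hZint] at this
      exact this
    obtain ⟨x0, -, hx0⟩ := hdense univ isOpen_univ univ_nonempty
    have hn0 : ‖V x0‖ ≠ 0 := norm_ne_zero_iff.2 hx0
    set ν : E2 := ‖V x0‖⁻¹ • V x0 with hν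
    have hν1 : ‖ν‖ = 1 := by
      rw [hν, norm_smul, norm_inv, norm_norm, inv_mul_cancel₀ hn0]
    have hself : V x0 = ‖V x0‖ • ν := by
      rw [hν, smul_smul, mul_inv_cancel₀ hn0, one_smul]
    have hprop : ∀ p y, V p ≠ 0 → V p = ‖V p‖ • ν → dist y p < δ₁ → V y = ‖V y‖ • ν := by
      intro p y hp hpν hd
      have h := aligned hK hD p (y - p) (by rwa [← dist_eq_norm])
      rw [add_sub_cancel, inner_eq_norm_mul_iff_real] at h
      have hpn : ‖V p‖ ≠ 0 := norm_ne_zero_iff.2 hp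
      rw [hpν, norm_smul, hν1, norm_norm, mul_one, smul_comm] at h
      exact smul_right_injective E2 hpn h
    refine ⟨ν, hν1, ?_⟩
    set T := interior {x | V x = ‖V x‖ • ν} with hT
    have hTne : T.Nonempty :=
      ⟨x0, mem_interior.2 ⟨ball x0 δ₁, fun y hy => hprop x0 y hx0 hself hy, isOpen_ball,
        mem_ball_self hδ⟩⟩
    have hTcl : IsClopen T := by
      refine ⟨?_, isOpen_interior⟩
      rw [← closure_subset_iff_isClosed]
      intro x hx
      rw [Metric.mem_closure_iff] at hx
      obtain ⟨y, hy, hxy⟩ := hx δ₁ hδ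
      obtain ⟨p, ⟨hpT, hpx⟩, hp⟩ := hdense (T ∩ ball x δ₁) (isOpen_interior.inter isOpen_ball)
        ⟨y, hy, by rwa [mem_ball, dist_comm]⟩
      have hpν : V p = ‖V p‖ • ν := (interior_subset (s := {x | V x = ‖V x‖ • ν}) hpT :)
      exact mem_interior.2 ⟨ball p δ₁, fun y hy => hprop p y hp hpν hy, isOpen_ball,
        by rwa [mem_ball, dist_comm]⟩
    have hu := hTcl.eq_univ hTne
    intro x
    have : x ∈ T := hu ▸ mem_univ x
    exact (interior_subset (s := {x | V x = ‖V x‖ • ν}) this :)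

lemma grad_coord (u : E2 → ℝ) (x : E2) (i : Fin 2) :
    gradient u x i = fderiv ℝ u x (EuclideanSpace.single i 1) := by
  rw [← inner_gradient_left, EuclideanSpace.inner_single_right]
  simp

lemma grad_sub (u : E2 → ℝ) (x y : E2) :
    ‖gradient u x - gradient u y‖ = ‖fderiv ℝ u x - fderiv ℝ u y‖ := by
  unfold gradient
  rw [← map_sub, LinearIsometryEquiv.norm_map]

lemma grad_norm (u : E2 → ℝ) (x : E2) : ‖gradient u x‖ = ‖fderiv ℝ u x‖ := by
  unfold gradient
  rw [LinearIsometryEquiv.norm_map]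

lemma dat_of {J₁ J₂ : E2 → ℝ} {δ₀ δ₁ : ℝ} (hK : KerOK (normK J₁ J₂) δ₀ δ₁)
    {f : ℝ → ℝ} (hf : ContDiff ℝ 1 f)
    {u : E2 → ℝ} (hu : ContDiff ℝ 3 u) (hub : BddDerivs 3 u)
    {Lu : E2 → ℝ} (hLu : ∀ x, HasPV (fun z => J₁ z + J₂ z) u x (Lu x))
    (heq : ∀ x, Lu x + f (u x) = 0)
    (hstab : ∀ ζ : E2 → ℝ,
      (∃ K, LipschitzWith K ζ) → HasCompactSupport ζ →
      (∫ x, deriv f (u x) * ζ x ^ 2) ≤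
        (1 / 2) * ∫ x, ∫ y, (ζ x - ζ y) ^ 2 * (J₁ (x - y) + J₂ (x - y))) :
    ∃ A M, Dat (normK J₁ J₂) (fun x => deriv f (u x)) (gradient u) A M := by
  obtain ⟨M0, hM0⟩ := hub 0 (by norm_num)
  obtain ⟨M1, hM1⟩ := hub 1 (by norm_num)
  obtain ⟨M2, hM2⟩ := hub 2 (by norm_num)
  simp only [norm_iteratedFDeriv_zero, Real.norm_eq_abs] at hM0
  simp only [norm_iteratedFDeriv_one] at hM1
  have hM2' : ∀ x, ‖fderiv ℝ (fderiv ℝ u) x‖ ≤ M2 := fun x => by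
    rw [← norm_iteratedFDeriv_one, norm_iteratedFDeriv_fderiv]
    exact hM2 x
  have hM1n : 0 ≤ M1 := (norm_nonneg _).trans (hM1 0)
  have hM2n : 0 ≤ M2 := (norm_nonneg _).trans (hM2 0)
  have hu1 : ContDiff ℝ 1 u := hu.of_le (by norm_num)
  have hfu : ContDiff ℝ 2 (fderiv ℝ u) := hu.fderiv_right (by norm_num)
  have hLu1 : LipschitzWith ⟨M1, hM1n⟩ u :=
    lipschitzWith_of_nnnorm_fderiv_le (hu1.differentiable (by norm_num)) (fun x => hM1 x)
  have hLu2 : LipschitzWith ⟨M2, hM2n⟩ (fderiv ℝ u) :=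
    lipschitzWith_of_nnnorm_fderiv_le (hfu.differentiable (by norm_num)) (fun x => hM2' x)
  have hC : ∀ x y, ‖fderiv ℝ u x - fderiv ℝ u y‖ ≤ M2 * ‖x - y‖ := fun x y => by
    have := hLu2.dist_le_mul x y
    rw [dist_eq_norm, dist_eq_norm] at this
    exact this
  refine ⟨M2, M1, ?_, ?_, ?_, ?_, ?_, ?_⟩
  · exact (hf.continuous_deriv (by norm_num)).comp hu.continuous
  · intro i
    simp only [grad_coord]
    exact hfu.clm_apply contDiff_const
  · intro x z
    rw [grad_sub]
    simpa using hC (x + z) x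
  · intro x
    rw [grad_norm]; exact hM1 x
  · intro i φ hφ hφs
    simp only [grad_coord]
    refine weak_lin hK hu1 hf (EuclideanSpace.single i 1) (lipR_of hLu1)
      (A' := M2 * ‖(EuclideanSpace.single i 1 : E2)‖) ?_ hC hM2n hM0
      (fun x => hasPV_norm (hLu x)) heq hφ hφs
    intro x z
    have h1 := (fderiv ℝ u (x + z) - fderiv ℝ u x).le_opNorm (EuclideanSpace.single i 1)
    have h2 := hC (x + z) x
    rw [add_sub_cancel_left] at h2
    rw [sub_apply, Real.norm_eq_abs] at h1
    refine h1.trans ?_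
    have := mul_le_mul_of_nonneg_right h2 (norm_nonneg (EuclideanSpace.single i 1 : E2))
    linarith
  · intro ζ C hζ hζs
    obtain ⟨R, hR⟩ := supp_bd hζs
    rw [← stab_conv (J := fun z => J₁ z + J₂ z) hK (fun z hz => by simp [normK, hz]) hζ hR]
    exact hstab ζ ⟨_, hζ.lip⟩ hζs

/-- De Giorgi-type result for sums of truncated kernels in two dimensions:
a bounded stable solution of `L[u] + f(u) = 0` in `ℝ²`, where the kernel is a sum
`J = J₁ + J₂` of two truncated fractional-type kernels, is one-dimensional. -/
theorem stmt_19
    (J₁ J₂ : EuclideanSpace ℝ (Fin 2) → ℝ)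
    (hJ₁meas : Measurable J₁) (hJ₂meas : Measurable J₂)
    (hJ₁nonneg : ∀ z, z ≠ 0 → 0 ≤ J₁ z) (hJ₂nonneg : ∀ z, z ≠ 0 → 0 ≤ J₂ z)
    (hJ₁even : ∀ z, z ≠ 0 → J₁ (-z) = J₁ z) (hJ₂even : ∀ z, z ≠ 0 → J₂ (-z) = J₂ z)
    (δ₀ δ₁ lam Lam α₁ α₂ β₁ β₂ : ℝ) (hδ₁ : 0 < δ₁) (hδ : δ₁ ≤ δ₀)
    (hlam : 0 < lam) (hLam : lam ≤ Lam)
    (hα₁ : 0 < α₁) (hα₁2 : α₁ < 2) (hα₂ : 0 < α₂) (hα₂2 : α₂ < 2)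
    (hβ₁ : 0 < β₁) (hβ₁2 : β₁ < 2) (hβ₂ : 0 < β₂) (hβ₂2 : β₂ < 2)
    (hJ₁low : ∀ z, z ≠ 0 → lam * ‖z‖ ^ (-(2:ℝ) - β₁) * (if ‖z‖ ≤ δ₁ then 1 else 0) ≤ J₁ z)
    (hJ₁up : ∀ z, z ≠ 0 → J₁ z ≤ Lam * ‖z‖ ^ (-(2:ℝ) - α₁) * (if ‖z‖ ≤ δ₀ then 1 else 0))
    (hJ₂low : ∀ z, z ≠ 0 → lam * ‖z‖ ^ (-(2:ℝ) - β₂) * (if ‖z‖ ≤ δ₁ then 1 else 0) ≤ J₂ z)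
    (hJ₂up : ∀ z, z ≠ 0 → J₂ z ≤ Lam * ‖z‖ ^ (-(2:ℝ) - α₂) * (if ‖z‖ ≤ δ₀ then 1 else 0))
    (f : ℝ → ℝ) (hf : ContDiff ℝ 1 f)
    (u : EuclideanSpace ℝ (Fin 2) → ℝ) (hu : ContDiff ℝ 3 u) (hub : BddDerivs 3 u)
    (Lu : EuclideanSpace ℝ (Fin 2) → ℝ)
    (hLu : ∀ x, HasPV (fun z => J₁ z + J₂ z) u x (Lu x))
    (heq : ∀ x, Lu x + f (u x) = 0)
    (hstab : ∀ ζ : EuclideanSpace ℝ (Fin 2) → ℝ,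
      (∃ K, LipschitzWith K ζ) → HasCompactSupport ζ →
      (∫ x, deriv f (u x) * ζ x ^ 2) ≤
        (1 / 2) * ∫ x, ∫ y, (ζ x - ζ y) ^ 2 * (J₁ (x - y) + J₂ (x - y))) :
    ∃ e : EuclideanSpace ℝ (Fin 2), ‖e‖ = 1 ∧ ∃ g : ℝ → ℝ,
      ∀ x, u x = g (@inner ℝ _ _ e x) := by
  have hK := kerOK_norm J₁ J₂ hJ₁meas hJ₂meas hJ₁nonneg hJ₂nonneg hJ₁even hJ₂even δ₀ δ₁ lam Lam
    α₁ α₂ β₁ hδ₁ hδ hlam hα₁2 hα₂2 hJ₁low hJ₁up hJ₂up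
  obtain ⟨A, M, hD⟩ := dat_of hK hf hu hub hLu heq hstab
  have hdiff : Differentiable ℝ u := hu.differentiable (by norm_num)
  rcases geom_final hK hD with h0 | ⟨ν, hν, hV⟩
  · refine ⟨EuclideanSpace.single 0 1, by simp, fun _ => u 0, fun x => ?_⟩
    refine is_const_of_fderiv_eq_zero (𝕜 := ℝ) hdiff (fun y => ?_) x 0
    rw [← norm_eq_zero, ← grad_norm, h0 y, norm_zero]
  · refine ⟨ν, hν, fun s => u (s • ν), fun x => ?_⟩
    set p : E2 := (inner ℝ ν x : ℝ) • ν with hp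
    have hperp : inner ℝ ν (x - p) = 0 := by
      rw [hp, inner_sub_right, inner_smul_right, real_inner_self_eq_norm_sq, hν]
      ring
    have hd : ∀ t : ℝ, HasDerivAt (fun t : ℝ => u (p + t • (x - p))) 0 t := by
      intro t
      have h1 : HasDerivAt (fun t : ℝ => p + t • (x - p)) (x - p) t := by
        simpa using ((hasDerivAt_id t).smul_const (x - p)).const_add p
      have h2 := (hdiff (p + t • (x - p))).hasFDerivAt.comp_hasDerivAt t h1
      rw [← inner_gradient_left, hV, inner_smul_left, hperp, mul_zero] at h2
      exact h2
    have hc := is_const_of_deriv_eq_zero (fun t => (hd t).differentiableAt)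
      (fun t => (hd t).deriv) 1 0
    simpa using hc
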